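/- arXiv:1901.02728 — 2 statements merged into one kernel-verified Lean document; each statement's English description precedes it below -/
import Mathlib

section
/- For any 0 < λ < λ* and 0 < μ < Γ(λ), i.e. for any pair (λ,μ) such that the system S_{λ,μ} admits a classical solution and (λ,μ) is below the critical curve, there exists a unique minimal classical solution (u,v) of S_{λ,μ}: the iterates (u_n, v_n) defined by (u₀,v₀)=(0,0) and −Δu_n = λf(x)/(1−v_{n−1})², −Δv_n = μg(x)/(1−u_{n−1})² in Ω with u_n = v_n = 0 on ∂Ω form a monotone increasing sequence converging uniformly to a classical solution (u,v), and any classical solution (U,V) of S_{λ,μ} satisfies u ≤ U and v ≤ V in Ω. -/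
open MeasureTheory Metric Set Filter Topology

noncomputable section

/-- Euclidean space `ℝ^N`. -/
abbrev Euc (N : ℕ) := EuclideanSpace ℝ (Fin N)

/-- Second derivative of `u` at `x` in the `i`-th coordinate direction. -/
noncomputable def secondDerivCoord {N : ℕ} (u : Euc N → ℝ) (i : Fin N) (x : Euc N) : ℝ :=
  deriv (fun t : ℝ => fderiv ℝ u (x + t • (EuclideanSpace.single i (1:ℝ)))
    (EuclideanSpace.single i (1:ℝ))) 0

/-- The Laplacian `Δu = ∑ ∂²u/∂xᵢ²`. -/
noncomputable def lap {N : ℕ} (u : Euc N → ℝ) (x : Euc N) : ℝ :=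
  ∑ i : Fin N, secondDerivCoord u i x

/-- A (smooth) bounded domain: open, bounded and nonempty. -/
def IsBddDomain {N : ℕ} (Ω : Set (Euc N)) : Prop :=
  IsOpen Ω ∧ Bornology.IsBounded Ω ∧ Ω.Nonempty

/-- Hypothesis (H): `f ∈ C^α(Ω̄)` for some `α ∈ (0,1]`, `0 ≤ f ≤ 1`, and `f > 0`
on a subset of `Ω` of positive measure. -/
def HypH {N : ℕ} (Ω : Set (Euc N)) (f : Euc N → ℝ) : Prop :=
  (∃ α : NNReal, 0 < α ∧ α ≤ 1 ∧ ∃ C : NNReal, HolderOnWith C α f (closure Ω)) ∧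
  (∀ x ∈ closure Ω, 0 ≤ f x ∧ f x ≤ 1) ∧
  0 < volume {x ∈ Ω | 0 < f x}

/-- A classical solution `(u,v)` of the system `S_{λ,μ}` on `Ω`:
`u, v ∈ C²(Ω) ∩ C(Ω̄)`, `0 ≤ u, v < 1` in `Ω`, `u = v = 0` on `∂Ω`,
`-Δu = λ f(x)/(1-v)²` and `-Δv = μ g(x)/(1-u)²` in `Ω`. -/
structure IsClassicalSolution {N : ℕ} (Ω : Set (Euc N)) (f g : Euc N → ℝ)
    (lam mu : ℝ) (u v : Euc N → ℝ) : Prop where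
  smooth_u : ContDiffOn ℝ 2 u Ω
  smooth_v : ContDiffOn ℝ 2 v Ω
  cont_u : ContinuousOn u (closure Ω)
  cont_v : ContinuousOn v (closure Ω)
  range_u : ∀ x ∈ Ω, 0 ≤ u x ∧ u x < 1
  range_v : ∀ x ∈ Ω, 0 ≤ v x ∧ v x < 1
  bdry_u : ∀ x ∈ frontier Ω, u x = 0
  bdry_v : ∀ x ∈ frontier Ω, v x = 0
  eq_u : ∀ x ∈ Ω, -lap u x = lam * f x / (1 - v x) ^ 2
  eq_v : ∀ x ∈ Ω, -lap v x = mu * g x / (1 - u x) ^ 2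

/-- A minimal solution: a classical solution lying below every classical solution. -/
def IsMinimalSolution {N : ℕ} (Ω : Set (Euc N)) (f g : Euc N → ℝ)
    (lam mu : ℝ) (u v : Euc N → ℝ) : Prop :=
  IsClassicalSolution Ω f g lam mu u v ∧
  ∀ U V : Euc N → ℝ, IsClassicalSolution Ω f g lam mu U V →
    ∀ x ∈ Ω, u x ≤ U x ∧ v x ≤ V x

/-- The existence region `Λ`: parameter pairs in the positive quadrant for which
the system has a classical solution. -/
def LambdaSet {N : ℕ} (Ω : Set (Euc N)) (f g : Euc N → ℝ) : Set (ℝ × ℝ) :=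
  {p | 0 < p.1 ∧ 0 < p.2 ∧ ∃ u v, IsClassicalSolution Ω f g p.1 p.2 u v}


/-- coordinate vector -/
abbrev ev {N : ℕ} (i : Fin N) : Euc N := EuclideanSpace.single i (1:ℝ)

lemma c2_fderiv {N : ℕ} {u : Euc N → ℝ} {x : Euc N} (h : ContDiffAt ℝ 2 u x) :
    ContDiffAt ℝ 1 (fderiv ℝ u) x := h.fderiv_right (by norm_num)

lemma c2_fderiv_diff {N : ℕ} {u : Euc N → ℝ} {x : Euc N} (h : ContDiffAt ℝ 2 u x) :
    DifferentiableAt ℝ (fderiv ℝ u) x := (c2_fderiv h).differentiableAt (by norm_num)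

lemma line_hasDeriv {N : ℕ} (x v : Euc N) (t : ℝ) :
    HasDerivAt (fun t : ℝ => x + t • v) v t := by
  simpa using ((hasDerivAt_id t).smul_const v).const_add x

lemma sdc_eq {N : ℕ} {u : Euc N → ℝ} {x : Euc N} (h : ContDiffAt ℝ 2 u x) (i : Fin N) :
    secondDerivCoord u i x = fderiv ℝ (fderiv ℝ u) x (ev i) (ev i) := by
  unfold secondDerivCoord
  have h1 : HasFDerivAt (fderiv ℝ u) (fderiv ℝ (fderiv ℝ u) x) (x + (0:ℝ) • ev i) := by
    simpa using (c2_fderiv_diff h).hasFDerivAt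
  have h2 := (h1.comp_hasDerivAt (0:ℝ) (line_hasDeriv x (ev i) 0))
  have h3 := h2.clm_apply (hasDerivAt_const (0:ℝ) (ev i))
  simpa using h3.deriv

lemma lap_eq {N : ℕ} {u : Euc N → ℝ} {x : Euc N} (h : ContDiffAt ℝ 2 u x) :
    lap u x = ∑ i, fderiv ℝ (fderiv ℝ u) x (ev i) (ev i) := by
  unfold lap
  exact Finset.sum_congr rfl (fun i _ => sdc_eq h i)

lemma lap_cont {N : ℕ} {Ω : Set (Euc N)} (hΩ : IsOpen Ω) {u : Euc N → ℝ}
    (h : ContDiffOn ℝ 2 u Ω) : ContinuousOn (lap u) Ω := by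
  intro x hx
  have h0 := h.contDiffAt (hΩ.mem_nhds hx)
  have h1 : ContinuousAt (fderiv ℝ (fderiv ℝ u)) x :=
    ((c2_fderiv h0).fderiv_right (m := 0) (by norm_num)).continuousAt
  have h2 : ContinuousAt (fun x => ∑ i, fderiv ℝ (fderiv ℝ u) x (ev i) (ev i)) x := by
    fun_prop
  refine (h2.congr ?_).continuousWithinAt
  filter_upwards [hΩ.mem_nhds hx] with y hy
  exact (lap_eq (h.contDiffAt (hΩ.mem_nhds hy))).symm

lemma sdc_nonpos {N : ℕ} {u : Euc N → ℝ} {x : Euc N} (h : ContDiffAt ℝ 2 u x)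
    (hm : IsLocalMax u x) (v : Euc N) : fderiv ℝ (fderiv ℝ u) x v v ≤ 0 := by
  by_contra hc
  push Not at hc
  set φ : ℝ → ℝ := fun t => u (x + t • v) with hφ
  have hx0 : x + (0:ℝ) • v = x := by simp
  have hcont : ContinuousAt (fun t : ℝ => x + t • v) 0 := by fun_prop
  have hten : Tendsto (fun t : ℝ => x + t • v) (𝓝 0) (𝓝 x) := by
    have := hcont.tendsto; rwa [hx0] at this
  have hmφ : IsLocalMax φ 0 := by
    have := hten.eventually hm
    filter_upwards [this] with t ht
    simpa [φ] using ht
  have hd : ∀ᶠ t in 𝓝 (0:ℝ), HasDerivAt φ (fderiv ℝ u (x + t • v) v) t := by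
    have := hten.eventually (h.eventually (by norm_num))
    filter_upwards [this] with t ht
    exact (ht.differentiableAt (by norm_num)).hasFDerivAt.comp_hasDerivAt t (line_hasDeriv x v t)
  have hde : deriv φ =ᶠ[𝓝 0] fun t => fderiv ℝ u (x + t • v) v := by
    filter_upwards [hd] with t ht using ht.deriv
  have hdd : deriv (deriv φ) 0 = fderiv ℝ (fderiv ℝ u) x v v := by
    rw [hde.deriv_eq]
    have h1 : HasFDerivAt (fderiv ℝ u) (fderiv ℝ (fderiv ℝ u) x) (x + (0:ℝ) • v) := by
      simpa using (c2_fderiv_diff h).hasFDerivAt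
    have h2 := (h1.comp_hasDerivAt (0:ℝ) (line_hasDeriv x v 0))
    have h3 := h2.clm_apply (hasDerivAt_const (0:ℝ) v)
    simpa using h3.deriv
  have hmin : IsLocalMin φ 0 := by
    apply isLocalMin_of_deriv_deriv_pos
    · rw [hdd]; exact hc
    · exact hmφ.deriv_eq_zero
    · exact hd.self_of_nhds.continuousAt
  have hconst : φ =ᶠ[𝓝 0] fun _ => φ 0 := by
    filter_upwards [hmin, hmφ] with t h1 h2 using le_antisymm h2 h1
  have h1 : deriv (deriv φ) 0 = 0 := by
    have := hconst.deriv.deriv_eq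
    rw [this]; simp
  linarith [hdd]

lemma normsq_c2 {N : ℕ} : ContDiff ℝ 2 (fun y : Euc N => ‖y‖ ^ 2) := contDiff_norm_sq ℝ

lemma normsq_fderiv {N : ℕ} (y : Euc N) :
    HasFDerivAt (fun y : Euc N => ‖y‖ ^ 2) ((2:ℝ) • innerSL ℝ y) y := by
  have h := (hasStrictFDerivAt_norm_sq y).hasFDerivAt
  rwa [← Nat.cast_smul_eq_nsmul ℝ, Nat.cast_ofNat] at h

lemma normsq_fderiv2 {N : ℕ} (y v : Euc N) :
    fderiv ℝ (fderiv ℝ (fun y : Euc N => ‖y‖ ^ 2)) y v v = 2 * ‖v‖ ^ 2 := by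
  have : fderiv ℝ (fun y : Euc N => ‖y‖ ^ 2) = fun y => (2:ℝ) • innerSL ℝ y := by
    funext y; exact (normsq_fderiv y).fderiv
  rw [this]
  have h : HasFDerivAt (fun y : Euc N => (2:ℝ) • innerSL ℝ y) ((2:ℝ) • (innerSL ℝ : Euc N →L[ℝ] _)) y :=
    ((2:ℝ) • (innerSL ℝ : Euc N →L[ℝ] Euc N →L[ℝ] ℝ)).hasFDerivAt
  rw [h.fderiv]
  simp
  exact real_inner_self_eq_norm_sq v

/-- weak maximum principle -/
lemma max_principle {N : ℕ} (hN : 2 ≤ N) {Ω : Set (Euc N)} (hΩ : IsBddDomain Ω) {w : Euc N → ℝ}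
    (hw : ContDiffOn ℝ 2 w Ω) (hc : ContinuousOn w (closure Ω))
    (hlap : ∀ x ∈ Ω, 0 ≤ lap w x) (hb : ∀ x ∈ frontier Ω, w x ≤ 0) : ∀ x ∈ Ω, w x ≤ 0 := by
  obtain ⟨ho, hbd, hne⟩ := hΩ
  have hcomp : IsCompact (closure Ω) := hbd.isCompact_closure
  obtain ⟨R, hR0, hR⟩ := hbd.closure.exists_pos_norm_le
  have key : ∀ ε > 0, ∀ x ∈ Ω, w x ≤ ε * R ^ 2 := by
    intro ε hε x hx
    set z : Euc N → ℝ := fun y => w y + ε * ‖y‖ ^ 2 with hz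
    have hzc : ContinuousOn z (closure Ω) := hc.add (by fun_prop)
    obtain ⟨m, hm, hmax⟩ := hcomp.exists_isMaxOn ⟨x, subset_closure hx⟩ hzc
    have hxm : z x ≤ z m := hmax (subset_closure hx)
    have hmR : ‖m‖ ^ 2 ≤ R ^ 2 := by
      have := hR m hm
      gcongr
    have hnot : m ∉ Ω := by
      intro hmΩ
      have hw0 := hw.contDiffAt (ho.mem_nhds hmΩ)
      have hq0 : ContDiffAt ℝ 2 (fun y : Euc N => ε * ‖y‖ ^ 2) m :=
        (contDiff_const.mul normsq_c2).contDiffAt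
      have hlm : IsLocalMax z m := by
        filter_upwards [ho.mem_nhds hmΩ] with y hy using hmax (subset_closure hy)
      have hz2 : ContDiffAt ℝ 2 z m := hw0.add hq0
      have hz1 : fderiv ℝ z =ᶠ[𝓝 m] fun y => fderiv ℝ w y + ε • fderiv ℝ (fun y : Euc N => ‖y‖ ^ 2) y := by
        filter_upwards [hw0.eventually (by norm_num)] with y hy
        have h1 := (hy.differentiableAt (by norm_num)).hasFDerivAt
        have h2 := (normsq_c2.differentiable (by norm_num) y).hasFDerivAt.const_mul ε
        exact (h1.add h2).fderiv
      have hz3 : ∀ v, fderiv ℝ (fderiv ℝ z) m v v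
          = fderiv ℝ (fderiv ℝ w) m v v + ε * (2 * ‖v‖ ^ 2) := by
        intro v
        have h1 := (c2_fderiv_diff hw0).hasFDerivAt
        have h2 := (c2_fderiv_diff (normsq_c2 (N := N)).contDiffAt (x := m)).hasFDerivAt.const_smul ε
        have h3 := (h1.add h2).fderiv
        have h4 : fderiv ℝ (fun y => fderiv ℝ w y + ε • fderiv ℝ (fun y : Euc N => ‖y‖ ^ 2) y) m
          = _ := h3
        rw [hz1.fderiv_eq, h4, ← normsq_fderiv2 m v]
        simp
      have h4 : ∀ i : Fin N, fderiv ℝ (fderiv ℝ w) m (ev i) (ev i) ≤ - (2 * ε) := by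
        intro i
        have h5 := sdc_nonpos hz2 hlm (ev i)
        rw [hz3] at h5
        simp at h5
        linarith
      have h6 := hlap m hmΩ
      rw [lap_eq hw0] at h6
      have h7 := Finset.sum_le_sum (s := Finset.univ) (fun i (_ : i ∈ Finset.univ) => h4 i)
      simp at h7
      have h8 : (2:ℝ) ≤ N := by exact_mod_cast hN
      nlinarith
    have hfr : m ∈ frontier Ω := by
      rw [frontier, ho.interior_eq]; exact ⟨hm, hnot⟩
    have := hb m hfr
    have h9 : 0 ≤ ε * ‖x‖ ^ 2 := by positivity
    have h10 : ε * ‖m‖ ^ 2 ≤ ε * R ^ 2 := by gcongr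
    simp only [hz] at hxm
    linarith
  intro x hx
  by_contra hcon
  push Not at hcon
  have h1 := key (w x / (2 * R ^ 2)) (by positivity) x hx
  have h2 : w x / (2 * R ^ 2) * R ^ 2 = w x / 2 := by field_simp
  rw [h2] at h1
  linarith

lemma lap_sub {N : ℕ} {u w : Euc N → ℝ} {x : Euc N} (hu : ContDiffAt ℝ 2 u x)
    (hw : ContDiffAt ℝ 2 w x) : lap (fun y => u y - w y) x = lap u x - lap w x := by
  rw [lap_eq hu, lap_eq hw, lap_eq (hu.sub hw), ← Finset.sum_sub_distrib]
  refine Finset.sum_congr rfl fun i _ => ?_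
  have hz1 : fderiv ℝ (fun y => u y - w y) =ᶠ[𝓝 x] fun y => fderiv ℝ u y - fderiv ℝ w y := by
    filter_upwards [hu.eventually (by norm_num), hw.eventually (by norm_num)] with y h1 h2
    exact ((h1.differentiableAt (by norm_num)).hasFDerivAt.sub
      (h2.differentiableAt (by norm_num)).hasFDerivAt).fderiv
  have h4 : fderiv ℝ (fun y => fderiv ℝ u y - fderiv ℝ w y) x = _ :=
    ((c2_fderiv_diff hu).hasFDerivAt.sub (c2_fderiv_diff hw).hasFDerivAt).fderiv
  rw [hz1.fderiv_eq, h4]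
  simp

lemma comparison {N : ℕ} (hN : 2 ≤ N) {Ω : Set (Euc N)} (hΩ : IsBddDomain Ω) {u w : Euc N → ℝ}
    (hu : ContDiffOn ℝ 2 u Ω) (huc : ContinuousOn u (closure Ω))
    (hw : ContDiffOn ℝ 2 w Ω) (hwc : ContinuousOn w (closure Ω))
    (hlap : ∀ x ∈ Ω, -lap u x ≤ -lap w x) (hbu : ∀ x ∈ frontier Ω, u x = 0)
    (hbw : ∀ x ∈ frontier Ω, w x = 0) : ∀ x ∈ Ω, u x ≤ w x := by
  have := max_principle hN hΩ (hu.sub hw) (huc.sub hwc) (fun x hx => by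
    have h1 := lap_sub (hu.contDiffAt (hΩ.1.mem_nhds hx)) (hw.contDiffAt (hΩ.1.mem_nhds hx))
    have h2 := hlap x hx
    rw [h1]
    linarith) (fun x hx => by simp [hbu x hx, hbw x hx])
  intro x hx
  have := this x hx
  simp at this
  exact this

open scoped ContDiff in
lemma smooth_aux (a : ℝ) {ψ : ℝ → ℝ} (hψ : ContDiff ℝ ∞ ψ) (h0 : ∀ s < 1/8, ψ s = 0) :
    ContDiff ℝ ∞ (fun s : ℝ => s ^ a * ψ s) := by
  rw [contDiff_iff_contDiffAt]
  intro s
  by_cases hs : s < 1/8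
  · have : (fun s : ℝ => s ^ a * ψ s) =ᶠ[𝓝 s] fun _ => 0 := by
      filter_upwards [gt_mem_nhds hs] with t ht
      simp [h0 t ht]
    exact contDiffAt_const.congr_of_eventuallyEq this
  · have hs' : s ≠ 0 := by intro h; apply hs; rw [h]; norm_num
    exact (Real.contDiffAt_rpow_const_of_ne hs').mul hψ.contDiffAt

/-- cutoff -/
def thet (s : ℝ) : ℝ := Real.smoothTransition (2 * s - 1)

open scoped ContDiff in
lemma thet_smooth : ContDiff ℝ ∞ thet :=
  Real.smoothTransition.contDiff.comp (by fun_prop)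

lemma thet_mono : Monotone thet := fun a b h => Real.smoothTransition.monotone (by linarith)

lemma thet_zero {s : ℝ} (h : s ≤ 1/2) : thet s = 0 :=
  Real.smoothTransition.zero_of_nonpos (by linarith)

lemma thet_one {s : ℝ} (h : 1 ≤ s) : thet s = 1 :=
  Real.smoothTransition.one_of_one_le (by linarith)

open scoped ContDiff in
lemma dthet_smooth : ContDiff ℝ ∞ (deriv thet) :=
  (contDiff_infty_iff_deriv.1 thet_smooth).2

lemma thet_hasDeriv (s : ℝ) : HasDerivAt thet (deriv thet s) s :=
  ((contDiff_infty_iff_deriv.1 thet_smooth).1 s).hasDerivAt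

lemma dthet_zero {s : ℝ} (h : s < 1/2) : deriv thet s = 0 := by
  have : thet =ᶠ[𝓝 s] fun _ => 0 := by
    filter_upwards [gt_mem_nhds h] with t ht using thet_zero ht.le
  rw [this.deriv_eq]; simp

lemma dthet_zero' {s : ℝ} (h : 1 < s) : deriv thet s = 0 := by
  have : thet =ᶠ[𝓝 s] fun _ => 1 := by
    filter_upwards [lt_mem_nhds h] with t ht using thet_one ht.le
  rw [this.deriv_eq]; simp

/-- radial derivative profile -/
def qf (N : ℕ) (s : ℝ) : ℝ := s ^ (-((N:ℝ) / 2)) * (thet s - thet (4 * s))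

/-- mollifier profile -/
def hf' (N : ℕ) (s : ℝ) : ℝ := s ^ (1 - (N:ℝ) / 2) * (4 * deriv thet s)

open scoped ContDiff in
lemma qf_smooth (N : ℕ) : ContDiff ℝ ∞ (qf N) := by
  apply smooth_aux
  · exact thet_smooth.sub (thet_smooth.comp (by fun_prop))
  · intro s hs; rw [thet_zero (by linarith), thet_zero (by linarith)]; simp

open scoped ContDiff in
lemma hf_smooth (N : ℕ) : ContDiff ℝ ∞ (hf' N) := by
  apply smooth_aux
  · exact contDiff_const.mul dthet_smooth
  · intro s hs; rw [dthet_zero (by linarith)]; simp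

lemma qf_zero (N : ℕ) {s : ℝ} (h : 1 ≤ s) : qf N s = 0 := by
  simp [qf, thet_one h, thet_one (show 1 ≤ 4 * s by linarith)]

lemma qf_zero' (N : ℕ) {s : ℝ} (h : s ≤ 1/8) : qf N s = 0 := by
  simp [qf, thet_zero (show s ≤ 1/2 by linarith), thet_zero (show 4 * s ≤ 1/2 by linarith)]

lemma qf_nonpos (N : ℕ) {s : ℝ} (h : 0 ≤ s) : qf N s ≤ 0 := by
  apply mul_nonpos_of_nonneg_of_nonpos (Real.rpow_nonneg h _)
  have := thet_mono (show s ≤ 4 * s by linarith)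
  linarith

/-- radial profile -/
def kap (N : ℕ) (s : ℝ) : ℝ := ∫ t in (1:ℝ)..s, qf N t

lemma kap_deriv (N : ℕ) (s : ℝ) : HasDerivAt (kap N) (qf N s) s :=
  intervalIntegral.integral_hasDerivAt_right ((qf_smooth N).continuous.intervalIntegrable _ _)
    ((qf_smooth N).continuous.stronglyMeasurableAtFilter _ _) (qf_smooth N).continuous.continuousAt

open scoped ContDiff in
lemma kap_smooth (N : ℕ) : ContDiff ℝ ∞ (kap N) := by
  rw [contDiff_infty_iff_deriv]
  refine ⟨fun s => (kap_deriv N s).differentiableAt, ?_⟩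
  have : deriv (kap N) = qf N := by funext s; exact (kap_deriv N s).deriv
  rw [this]; exact qf_smooth N

lemma kap_zero (N : ℕ) {s : ℝ} (h : 1 ≤ s) : kap N s = 0 := by
  unfold kap
  rw [intervalIntegral.integral_congr (g := fun _ => (0:ℝ))]
  · simp
  · intro t ht
    rw [uIcc_of_le h] at ht
    exact qf_zero N ht.1

lemma kap_nonneg (N : ℕ) {s : ℝ} (h0 : 0 ≤ s) : 0 ≤ kap N s := by
  rcases le_total 1 s with h | h
  · rw [kap_zero N h]
  · unfold kap
    rw [intervalIntegral.integral_symm, ← intervalIntegral.integral_neg]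
    apply intervalIntegral.integral_nonneg h
    intro t ht
    have := qf_nonpos N (h0.trans ht.1)
    linarith

lemma kap_pos (N : ℕ) : 0 < kap N 0 := by
  unfold kap
  rw [intervalIntegral.integral_symm, ← intervalIntegral.integral_neg]
  apply intervalIntegral.integral_pos (by norm_num) (qf_smooth N).continuous.neg.continuousOn
  · intro t ht
    have := qf_nonpos N ht.1.le
    simp only [Pi.neg_apply]
    linarith
  · refine ⟨1/2, by norm_num, ?_⟩
    simp only [Pi.neg_apply, qf]
    rw [thet_zero le_rfl, thet_one (by norm_num)]
    have : (0:ℝ) < (1/2:ℝ) ^ (-((N:ℝ) / 2)) := by positivity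
    linarith

/-- the compactly supported kernel -/
def Kf (N : ℕ) (y : Euc N) : ℝ := kap N (‖y‖ ^ 2)

/-- the mollifier -/
def etaf (N : ℕ) (y : Euc N) : ℝ := hf' N (‖y‖ ^ 2)

lemma Kf_c2 (N : ℕ) : ContDiff ℝ 2 (Kf N) :=
  ((kap_smooth N).of_le (WithTop.coe_le_coe.2 le_top)).comp normsq_c2

lemma etaf_c2 (N : ℕ) : ContDiff ℝ 2 (etaf N) :=
  ((hf_smooth N).of_le (WithTop.coe_le_coe.2 le_top)).comp normsq_c2

lemma Kf_zero {N : ℕ} {y : Euc N} (h : 1 < ‖y‖) : Kf N y = 0 :=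
  kap_zero N (by nlinarith)

lemma etaf_zero {N : ℕ} {y : Euc N} (h : 1 < ‖y‖) : etaf N y = 0 := by
  simp [etaf, hf', dthet_zero' (show 1 < ‖y‖ ^ 2 by nlinarith)]

lemma supp_of_zero {N : ℕ} {Z : Type*} [Zero Z] {k : Euc N → Z} (h : ∀ y, 1 < ‖y‖ → k y = 0) :
    tsupport k ⊆ closedBall 0 1 := by
  apply closure_minimal _ isClosed_closedBall
  intro y hy
  by_contra hc
  simp at hc
  exact hy (h y hc)

lemma cs_of_zero {N : ℕ} {Z : Type*} [Zero Z] {k : Euc N → Z} (h : ∀ y, 1 < ‖y‖ → k y = 0) :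
    HasCompactSupport k :=
  (isCompact_closedBall (0 : Euc N) 1).of_isClosed_subset (isClosed_tsupport k) (supp_of_zero h)

lemma Kf_int_pos (N : ℕ) : 0 < ∫ y, Kf N y := by
  apply (Kf_c2 N).continuous.integral_pos_of_hasCompactSupport_nonneg_nonzero (x := 0)
    (cs_of_zero fun y => Kf_zero)
  · intro y; exact kap_nonneg N (by positivity)
  · simpa [Kf] using (kap_pos N).ne'

lemma etaf_int_pos {N : ℕ} (hN : 2 ≤ N) : 0 < ∫ y, etaf N y := by
  obtain ⟨s, hs, hs'⟩ := exists_hasDerivAt_eq_slope thet (deriv thet) (show (1/2:ℝ) < 1 by norm_num)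
    thet_smooth.continuous.continuousOn (fun x _ => thet_hasDeriv x)
  rw [thet_one le_rfl, thet_zero le_rfl] at hs'
  have hs0 : 0 < s := by linarith [hs.1]
  set y0 : Euc N := EuclideanSpace.single ⟨0, by omega⟩ (Real.sqrt s)
  have hy0 : ‖y0‖ ^ 2 = s := by simp [y0, Real.sq_sqrt hs0.le]
  apply (etaf_c2 N).continuous.integral_pos_of_hasCompactSupport_nonneg_nonzero (x := y0)
    (cs_of_zero fun y => etaf_zero)
  · intro y
    apply mul_nonneg (Real.rpow_nonneg (by positivity) _)
    have : 0 ≤ deriv thet (‖y‖ ^ 2) := thet_mono.deriv_nonneg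
    simp; linarith
  · unfold etaf hf'
    rw [hy0, hs']
    have : (0:ℝ) < s ^ (1 - (N:ℝ) / 2) := by positivity
    norm_num
    exact this.ne'

lemma Kf_fderiv {N : ℕ} (y : Euc N) :
    HasFDerivAt (Kf N) ((2 * qf N (‖y‖ ^ 2)) • innerSL ℝ y) y := by
  have := (kap_deriv N (‖y‖ ^ 2)).comp_hasFDerivAt y (normsq_fderiv y)
  rw [smul_smul, mul_comm] at this
  exact this

lemma qf_deriv (N : ℕ) {s : ℝ} (hs : 0 < s) : 4 * s * deriv (qf N) s + 2 * N * qf N s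
    = hf' N s - 2 ^ N * hf' N (4 * s) := by
  have h1 : HasDerivAt (fun s : ℝ => s ^ (-((N:ℝ) / 2)))
      ((-((N:ℝ) / 2)) * s ^ (-((N:ℝ) / 2) - 1)) s :=
    Real.hasDerivAt_rpow_const (Or.inl hs.ne')
  have h2 : HasDerivAt (fun s : ℝ => thet (4 * s)) (deriv thet (4 * s) * 4) s := by
    have := (thet_hasDeriv (4 * s)).comp s ((hasDerivAt_id s).const_mul 4)
    rw [mul_one] at this
    exact this
  have h3 : deriv (qf N) s = _ := (h1.mul ((thet_hasDeriv s).sub h2)).deriv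
  rw [h3]
  simp only [Pi.sub_apply]
  unfold qf hf'
  have e1 : s ^ (-((N:ℝ) / 2) - 1) * s = s ^ (-((N:ℝ) / 2)) := by
    rw [Real.rpow_sub_one hs.ne']; field_simp
  have e2 : s ^ (1 - (N:ℝ) / 2) = s * s ^ (-((N:ℝ) / 2)) := by
    rw [sub_eq_add_neg, Real.rpow_add hs, Real.rpow_one]
  have e3 : (4 * s) ^ (1 - (N:ℝ) / 2) * 2 ^ N = 4 * s ^ (1 - (N:ℝ) / 2) := by
    rw [Real.mul_rpow (by norm_num) hs.le, sub_eq_add_neg, Real.rpow_add (by norm_num : (0:ℝ) < 4),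
      Real.rpow_one]
    have : (4:ℝ) ^ (-((N:ℝ) / 2)) * 2 ^ N = 1 := by
      rw [show (4:ℝ) = 2 ^ (2:ℝ) by norm_num, ← Real.rpow_mul (by norm_num), ← Real.rpow_natCast 2 N,
        ← Real.rpow_add (by norm_num)]
      ring_nf
      simp
    calc _ = 4 * s ^ (1 + -((N:ℝ) / 2)) * ((4:ℝ) ^ (-((N:ℝ) / 2)) * 2 ^ N) := by ring
      _ = _ := by rw [this, mul_one]
  have e4 : (2:ℝ) ^ N * ((4 * s) ^ (1 - (N:ℝ) / 2) * (4 * deriv thet (4 * s)))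
      = 16 * (s * s ^ (-((N:ℝ) / 2))) * deriv thet (4 * s) := by
    rw [← e2]; linear_combination 4 * deriv thet (4 * s) * e3
  rw [e4, e2]
  linear_combination (-2 * N * (thet s - thet (4 * s))) * e1

lemma Kf_lap {N : ℕ} (hN : 2 ≤ N) (y : Euc N) :
    lap (Kf N) y = etaf N y - 2 ^ N * etaf N ((2:ℝ) • y) := by
  rw [lap_eq (Kf_c2 N).contDiffAt]
  have hf : fderiv ℝ (Kf N) = fun y => (2 * qf N (‖y‖ ^ 2)) • innerSL ℝ y := by
    funext y; exact (Kf_fderiv y).fderiv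
  have hq : HasDerivAt (qf N) (deriv (qf N) (‖y‖ ^ 2)) (‖y‖ ^ 2) :=
    ((contDiff_infty_iff_deriv.1 (qf_smooth N)).1 _).hasDerivAt
  have h1 : HasFDerivAt (fun y : Euc N => 2 * qf N (‖y‖ ^ 2))
      ((2:ℝ) • (deriv (qf N) (‖y‖ ^ 2) • ((2:ℝ) • innerSL ℝ y))) y :=
    (HasDerivAt.comp_hasFDerivAt (h₂ := qf N) y hq (normsq_fderiv y)).const_mul 2
  have h2 : HasFDerivAt (fun y : Euc N => innerSL ℝ y) (innerSL ℝ : Euc N →L[ℝ] _) y :=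
    (innerSL ℝ : Euc N →L[ℝ] Euc N →L[ℝ] ℝ).hasFDerivAt
  have h3 : ∀ i, fderiv ℝ (fderiv ℝ (Kf N)) y (ev i) (ev i)
      = 2 * qf N (‖y‖ ^ 2) + 4 * deriv (qf N) (‖y‖ ^ 2) * (y i) ^ 2 := by
    intro i
    have h4 : fderiv ℝ (fun y : Euc N => (2 * qf N (‖y‖ ^ 2)) • innerSL ℝ y) y = _ := (h1.smul h2).fderiv
    rw [hf, h4]
    have h5 : innerSL ℝ (ev i) (ev i) = (1:ℝ) := by
      change inner ℝ (ev i) (ev i) = (1:ℝ)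
      rw [real_inner_self_eq_norm_sq]; simp
    have h6 : innerSL ℝ y (ev i) = y i := by
      change inner ℝ y (ev i) = y i
      simp [EuclideanSpace.inner_single_right]
    simp only [add_apply, smul_apply,
      ContinuousLinearMap.smulRight_apply, smul_eq_mul]
    rw [h5, h6]; ring
  simp_rw [h3]
  rw [Finset.sum_add_distrib, ← Finset.mul_sum (a := 4 * deriv (qf N) (‖y‖ ^ 2)), ← EuclideanSpace.real_norm_sq_eq y]
  have h7 : etaf N ((2:ℝ) • y) = hf' N (4 * ‖y‖ ^ 2) := by
    unfold etaf; rw [norm_smul, mul_pow]; norm_num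
  rw [h7]
  simp only [Finset.sum_const, Finset.card_univ, Fintype.card_fin, nsmul_eq_mul]
  rcases eq_or_ne y 0 with rfl | hy
  · simp [etaf, hf', qf_zero' N (show (0:ℝ) ≤ 1/8 by norm_num), dthet_zero (show (0:ℝ) < 1/2 by norm_num)]
  · have := qf_deriv N (show 0 < ‖y‖ ^ 2 by positivity)
    unfold etaf
    linear_combination this

lemma integrable_mul_cs {N : ℕ} {Z : Type*} [NormedAddCommGroup Z] [NormedSpace ℝ Z]
    {p : Euc N → ℝ} {k : Euc N → Z}
    (hp : ContinuousOn p (closedBall 0 1)) (hk : Continuous k) (h0 : ∀ y, 1 < ‖y‖ → k y = 0) :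
    Integrable (fun y => p y • k y) := by
  have h1 : IntegrableOn (fun y => p y • k y) (closedBall 0 1) :=
    (hp.smul hk.continuousOn).integrableOn_compact (isCompact_closedBall _ _)
  rwa [integrableOn_iff_integrable_of_support_subset] at h1
  intro y hy
  by_contra hc
  simp at hc
  apply hy
  simp [h0 y hc]

lemma fderiv_zero_out {N : ℕ} {Z : Type*} [NormedAddCommGroup Z] [NormedSpace ℝ Z]
    {k : Euc N → Z} (h0 : ∀ y, 1 < ‖y‖ → k y = 0) : ∀ y, 1 < ‖y‖ → fderiv ℝ k y = 0 := by
  intro y hy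
  have : k =ᶠ[𝓝 y] fun _ => 0 := by
    have : ∀ᶠ z : Euc N in 𝓝 y, 1 < ‖z‖ := continuous_norm.continuousAt.eventually (lt_mem_nhds hy)
    filter_upwards [this] with z hz using h0 z hz
  rw [this.fderiv_eq]; simp

lemma ibp1 {N : ℕ} {p k : Euc N → ℝ} (hp : ContDiffOn ℝ 1 p (ball 0 2)) (hk : ContDiff ℝ 1 k)
    (h0 : ∀ y, 1 < ‖y‖ → k y = 0) (v : Euc N) :
    ∫ y, p y * fderiv ℝ k y v = - ∫ y, fderiv ℝ p y v * k y := by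
  have hsub : closedBall (0 : Euc N) 1 ⊆ ball 0 2 := closedBall_subset_ball (by norm_num)
  have hfk : Continuous (fun y => fderiv ℝ k y v) :=
    (hk.continuous_fderiv (by norm_num)).clm_apply continuous_const
  have hfp : ContinuousOn (fun y => fderiv ℝ p y v) (ball 0 2) :=
    (hp.continuousOn_fderiv_of_isOpen isOpen_ball (by norm_num)).clm_apply continuousOn_const
  have h0' : ∀ y, 1 < ‖y‖ → fderiv ℝ k y v = 0 := fun y hy => by
    rw [fderiv_zero_out h0 y hy]; simp
  apply integral_mul_fderiv_eq_neg_fderiv_mul_of_integrable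
  · exact integrable_mul_cs (hfp.mono hsub) hk.continuous h0
  · exact integrable_mul_cs (hp.continuousOn.mono hsub) hfk h0'
  · exact integrable_mul_cs (hp.continuousOn.mono hsub) hk.continuous h0
  · intro y hy
    have := hsub (supp_of_zero h0 hy)
    exact (hp.contDiffAt (isOpen_ball.mem_nhds this)).differentiableAt (by norm_num)
  · intro y _
    exact (hk.differentiable (by norm_num)) y

lemma fderiv_apply_fderiv {N : ℕ} {p : Euc N → ℝ} {y : Euc N} (h : ContDiffAt ℝ 2 p y) (v w : Euc N) :
    fderiv ℝ (fun y => fderiv ℝ p y v) y w = fderiv ℝ (fderiv ℝ p) y w v := by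
  have := (c2_fderiv_diff h).hasFDerivAt.clm_apply (hasFDerivAt_const v y)
  rw [this.fderiv]; simp

lemma ibp2 {N : ℕ} {p k : Euc N → ℝ} (hp : ContDiffOn ℝ 2 p (ball 0 2)) (hk : ContDiff ℝ 2 k)
    (h0 : ∀ y, 1 < ‖y‖ → k y = 0) :
    ∫ y, p y * lap k y = ∫ y, lap p y * k y := by
  have hsub : closedBall (0 : Euc N) 1 ⊆ ball 0 2 := closedBall_subset_ball (by norm_num)
  have hD : ContDiffOn ℝ 1 (fderiv ℝ p) (ball 0 2) := hp.fderiv_of_isOpen isOpen_ball (by norm_num)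
  have hDk : ContDiff ℝ 1 (fderiv ℝ k) := hk.fderiv_right (by norm_num)
  have hDD : ContinuousOn (fderiv ℝ (fderiv ℝ p)) (ball 0 2) :=
    hD.continuousOn_fderiv_of_isOpen isOpen_ball (by norm_num)
  have hDDk : Continuous (fderiv ℝ (fderiv ℝ k)) := hDk.continuous_fderiv (by norm_num)
  have h0' := fderiv_zero_out h0
  have h0'' := fderiv_zero_out h0'
  have e1 : ∀ y, p y * lap k y = ∑ i, p y * fderiv ℝ (fderiv ℝ k) y (ev i) (ev i) := fun y => by
    rw [lap_eq hk.contDiffAt, Finset.mul_sum]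
  have e2 : ∀ y, lap p y * k y = ∑ i, fderiv ℝ (fderiv ℝ p) y (ev i) (ev i) * k y := fun y => by
    by_cases hy : 1 < ‖y‖
    · simp [h0 y hy]
    · have hy' : y ∈ ball (0 : Euc N) 2 := hsub (by simpa using hy)
      rw [lap_eq (hp.contDiffAt (isOpen_ball.mem_nhds hy')), Finset.sum_mul]
  simp_rw [e1, e2]
  rw [integral_finsetSum, integral_finsetSum]
  · refine Finset.sum_congr rfl fun i _ => ?_
    have a1 := ibp1 (hp.of_le (by norm_num)) (k := fun y => fderiv ℝ k y (ev i))
      (hDk.clm_apply contDiff_const) (fun y hy => by simp [h0' y hy]) (ev i)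
    have a2 := ibp1 (p := fun y => fderiv ℝ p y (ev i)) (hD.clm_apply contDiffOn_const)
      (hk.of_le (by norm_num)) h0 (ev i)
    have a3 : ∀ y, p y * fderiv ℝ (fun y => fderiv ℝ k y (ev i)) y (ev i)
        = p y * fderiv ℝ (fderiv ℝ k) y (ev i) (ev i) := fun y => by
      rw [fderiv_apply_fderiv hk.contDiffAt]
    have a4 : ∀ y, fderiv ℝ (fun y => fderiv ℝ p y (ev i)) y (ev i) * k y
        = fderiv ℝ (fderiv ℝ p) y (ev i) (ev i) * k y := fun y => by
      by_cases hy : 1 < ‖y‖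
      · simp [h0 y hy]
      · have hy' : y ∈ ball (0 : Euc N) 2 := hsub (by simpa using hy)
        rw [fderiv_apply_fderiv (hp.contDiffAt (isOpen_ball.mem_nhds hy'))]
    simp_rw [a3] at a1
    simp_rw [a4] at a2
    rw [a1, a2, neg_neg]
  · intro i _
    exact integrable_mul_cs (((hDD.clm_apply continuousOn_const).clm_apply continuousOn_const).mono hsub)
      hk.continuous h0
  · intro i _
    exact integrable_mul_cs (hp.continuousOn.mono hsub)
      ((hDDk.clm_apply continuous_const).clm_apply continuous_const)
      (fun y hy => by simp [h0'' y hy])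

lemma aff_hasFDeriv {N : ℕ} (x : Euc N) (c : ℝ) (y : Euc N) :
    HasFDerivAt (fun y : Euc N => x - c • y) (-(c • ContinuousLinearMap.id ℝ (Euc N))) y := by
  simpa using ((hasFDerivAt_id y).const_smul c).const_sub x

lemma lap_aff {N : ℕ} {u : Euc N → ℝ} {x : Euc N} {c : ℝ} {y : Euc N}
    (h : ContDiffAt ℝ 2 u (x - c • y)) :
    lap (fun y => u (x - c • y)) y = c ^ 2 * lap u (x - c • y) := by
  have hA : ContDiff ℝ 2 (fun y : Euc N => x - c • y) := by fun_prop
  have hcomp : ContDiffAt ℝ 2 (fun y => u (x - c • y)) y :=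
    ContDiffAt.comp y h hA.contDiffAt
  rw [lap_eq hcomp, lap_eq h, Finset.mul_sum]
  refine Finset.sum_congr rfl fun i _ => ?_
  have h1 : fderiv ℝ (fun y => u (x - c • y)) =ᶠ[𝓝 y] fun y => (-c) • fderiv ℝ u (x - c • y) := by
    have := hA.continuous.continuousAt.eventually (h.eventually (by norm_num))
    filter_upwards [this] with z hz
    have h2 := (hz.differentiableAt (by norm_num)).hasFDerivAt.comp z (aff_hasFDeriv x c z)
    have h3 : fderiv ℝ (fun y => u (x - c • y)) z = _ := h2.fderiv
    rw [h3]
    ext v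
    simp
  have h4 := (((c2_fderiv_diff h).hasFDerivAt.comp y (aff_hasFDeriv x c y)).const_smul (-c))
  have h5 : fderiv ℝ (fun y => (-c) • fderiv ℝ u (x - c • y)) y = _ := h4.fderiv
  rw [h1.fderiv_eq, h5]
  simp
  ring

lemma ibp {N : ℕ} {Ω : Set (Euc N)} (hΩ : IsOpen Ω) {u k : Euc N → ℝ} (hu : ContDiffOn ℝ 2 u Ω)
    (hk : ContDiff ℝ 2 k) (h0 : ∀ y, 1 < ‖y‖ → k y = 0) {x : Euc N} {c : ℝ} (hc : 0 < c)
    (hs : ball x (2 * c) ⊆ Ω) :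
    ∫ y, u (x - c • y) * lap k y = c ^ 2 * ∫ y, lap u (x - c • y) * k y := by
  have hmaps : ∀ y ∈ ball (0 : Euc N) 2, x - c • y ∈ Ω := by
    intro y hy
    apply hs
    simp [dist_eq_norm, norm_smul, abs_of_pos hc] at hy ⊢
    nlinarith
  have hA : ContDiff ℝ 2 (fun y : Euc N => x - c • y) := by fun_prop
  have hp : ContDiffOn ℝ 2 (fun y => u (x - c • y)) (ball 0 2) :=
    hu.comp hA.contDiffOn hmaps
  rw [ibp2 hp hk h0, ← integral_const_mul]
  congr 1
  funext y
  by_cases hy : 1 < ‖y‖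
  · simp [h0 y hy]
  · have hy' : y ∈ ball (0 : Euc N) 2 := by
      simp at hy ⊢; linarith
    rw [lap_aff (hu.contDiffAt (hΩ.mem_nhds (hmaps y hy')))]
    ring

/-- convolution -/
def Cv {N : ℕ} {Z : Type*} [NormedAddCommGroup Z] [NormedSpace ℝ Z] (H : Euc N → ℝ) (k : Euc N → Z)
    (ξ : Euc N) : Z := ∫ y, H (ξ - y) • k y

lemma Cv_eq {N : ℕ} {Z : Type*} [NormedAddCommGroup Z] [NormedSpace ℝ Z] (H : Euc N → ℝ)
    (k : Euc N → Z) : Cv H k =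
      MeasureTheory.convolution H k (ContinuousLinearMap.lsmul ℝ ℝ) volume := by
  funext ξ
  rw [convolution_eq_swap]; rfl

lemma Cv_contDiff {N : ℕ} {H : Euc N → ℝ} {k : Euc N → ℝ} (hH : Continuous H) (hk : ContDiff ℝ 2 k)
    (h0 : ∀ y, 1 < ‖y‖ → k y = 0) : ContDiff ℝ 2 (Cv H k) := by
  rw [Cv_eq]
  exact HasCompactSupport.contDiff_convolution_right (n := 2) _ (cs_of_zero h0)
    hH.locallyIntegrable hk

lemma Cv_fderiv {N : ℕ} {Z : Type*} [NormedAddCommGroup Z] [NormedSpace ℝ Z]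
    {H : Euc N → ℝ} {k : Euc N → Z} (hH : Continuous H)
    (hk : ContDiff ℝ 1 k) (h0 : ∀ y, 1 < ‖y‖ → k y = 0) (ξ : Euc N) :
    HasFDerivAt (Cv H k) (Cv H (fderiv ℝ k) ξ) ξ := by
  rw [Cv_eq, Cv_eq]
  have := HasCompactSupport.hasFDerivAt_convolution_right (ContinuousLinearMap.lsmul ℝ ℝ)
    (cs_of_zero h0) (hH.locallyIntegrable (μ := volume)) hk ξ
  have hL : (ContinuousLinearMap.lsmul ℝ ℝ : ℝ →L[ℝ] Z →L[ℝ] Z).precompR (Euc N)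
      = ContinuousLinearMap.lsmul ℝ ℝ := by
    ext a φ v
    simp
  rw [hL] at this
  exact this

lemma Cv_bound {N : ℕ} {Z : Type*} [NormedAddCommGroup Z] [NormedSpace ℝ Z]
    {H : Euc N → ℝ} {k : Euc N → Z} {M : ℝ} {ξ : Euc N} (hM : ∀ y, ‖y‖ ≤ 1 → |H (ξ - y)| ≤ M)
    (hk : Continuous k) (h0 : ∀ y, 1 < ‖y‖ → k y = 0) :
    ‖Cv H k ξ‖ ≤ M * ∫ y, ‖k y‖ := by
  unfold Cv
  rw [← integral_const_mul]
  apply norm_integral_le_of_norm_le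
  · have := integrable_mul_cs (p := fun _ => M) (k := fun y => ‖k y‖) continuousOn_const hk.norm
      (fun y hy => by simp [h0 y hy])
    exact this
  · refine Eventually.of_forall fun y => ?_
    by_cases hy : 1 < ‖y‖
    · simp [h0 y hy]
    · rw [norm_smul, Real.norm_eq_abs]
      gcongr
      exact hM y (by simpa using hy)

lemma int_fderiv_zero {N : ℕ} {Z : Type*} [NormedAddCommGroup Z] [NormedSpace ℝ Z]
    {k : Euc N → Z} (hk : ContDiff ℝ 1 k) (h0 : ∀ y, 1 < ‖y‖ → k y = 0) :
    ∫ y, fderiv ℝ k y = 0 := by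
  have h1 := Cv_fderiv (H := fun _ => (1:ℝ)) continuous_const hk h0 0
  have h2 : Cv (fun _ : Euc N => (1:ℝ)) k = fun _ => ∫ y, k y := by
    funext ξ; simp [Cv]
  rw [h2] at h1
  have h3 := h1.unique (hasFDerivAt_const _ _)
  simpa [Cv] using h3

lemma Cv_fderiv_bound {N : ℕ} {Z : Type*} [NormedAddCommGroup Z] [NormedSpace ℝ Z]
    {H : Euc N → ℝ} {k : Euc N → Z} {A : ℝ} {ξ : Euc N} (hH : Continuous H)
    (hA : ∀ y, ‖y‖ ≤ 1 → |H (ξ - y) - H ξ| ≤ A)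
    (hk : ContDiff ℝ 1 k) (h0 : ∀ y, 1 < ‖y‖ → k y = 0) :
    ‖Cv H (fderiv ℝ k) ξ‖ ≤ A * ∫ y, ‖fderiv ℝ k y‖ := by
  have hc := hk.continuous_fderiv (by norm_num)
  have h0' := fderiv_zero_out h0
  have e : Cv H (fderiv ℝ k) ξ = Cv (fun z => H z - H ξ) (fderiv ℝ k) ξ := by
    unfold Cv
    simp_rw [sub_smul]
    rw [integral_sub, integral_smul, int_fderiv_zero hk h0]
    · simp
    · exact integrable_mul_cs (p := fun y => H (ξ - y)) (by fun_prop) hc h0'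
    · exact integrable_mul_cs (p := fun y => H ξ) (by fun_prop) hc h0'
  rw [e]
  exact Cv_bound hA hc h0'

/-- scaled average -/
def Aop {N : ℕ} (F k : Euc N → ℝ) (δ : ℝ) (x : Euc N) : ℝ := ∫ y, F (x - δ • y) * k y

lemma Aop_cont {N : ℕ} {F k : Euc N → ℝ} (hF : Continuous F) (hk : Continuous k)
    (h0 : ∀ y, 1 < ‖y‖ → k y = 0) (x : Euc N) : Continuous (fun δ : ℝ => Aop F k δ x) := by
  have h1 : ∀ δ, Aop F k δ x = ∫ y in closedBall (0 : Euc N) 1, F (x - δ • y) * k y := by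
    intro δ
    rw [setIntegral_eq_integral_of_forall_compl_eq_zero]; rfl
    intro y hy
    simp at hy
    simp [h0 y hy]
  simp_rw [h1]
  apply continuous_parametric_integral_of_continuous _ (isCompact_closedBall _ _)
  fun_prop

lemma Aop_zero {N : ℕ} (F k : Euc N → ℝ) (x : Euc N) : Aop F k 0 x = F x * ∫ y, k y := by
  simp [Aop, integral_const_mul]

lemma Aop_Cv {N : ℕ} (F k : Euc N → ℝ) {δ : ℝ} (hδ : 0 < δ) :
    Aop F k δ = fun x => Cv (fun z => F (δ • z)) k (δ⁻¹ • x) := by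
  funext x
  unfold Aop Cv
  congr 1
  funext y
  show F (x - δ • y) * k y = F (δ • (δ⁻¹ • x - y)) • k y
  rw [smul_sub, smul_smul, mul_inv_cancel₀ hδ.ne', one_smul, smul_eq_mul]

lemma Aop_bound {N : ℕ} {F k : Euc N → ℝ} {δ M : ℝ} {x : Euc N}
    (hM : ∀ y, |F y| ≤ M) (hδ : 0 < δ) (hk : Continuous k)
    (h0 : ∀ y, 1 < ‖y‖ → k y = 0) : |Aop F k δ x| ≤ M * ∫ y, ‖k y‖ := by
  rw [Aop_Cv F k hδ]
  exact Cv_bound (H := fun z => F (δ • z)) (ξ := δ⁻¹ • x) (fun y _ => hM _) hk h0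

lemma Aop_contDiff {N : ℕ} {F k : Euc N → ℝ} (hF : Continuous F) {δ : ℝ} (hδ : 0 < δ)
    (hk : ContDiff ℝ 2 k) (h0 : ∀ y, 1 < ‖y‖ → k y = 0) : ContDiff ℝ 2 (Aop F k δ) := by
  rw [Aop_Cv F k hδ]
  exact (Cv_contDiff (by fun_prop) hk h0).comp (by fun_prop)

lemma Aop_fderiv {N : ℕ} {F k : Euc N → ℝ} (hF : Continuous F) {δ : ℝ} (hδ : 0 < δ)
    (hk : ContDiff ℝ 2 k) (h0 : ∀ y, 1 < ‖y‖ → k y = 0) :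
    fderiv ℝ (Aop F k δ) = fun x => δ⁻¹ • Cv (fun z => F (δ • z)) (fderiv ℝ k) (δ⁻¹ • x) := by
  funext x
  rw [Aop_Cv F k hδ]
  rw [fderiv_comp_smul (f := Cv (fun z => F (δ • z)) k)]
  rw [(Cv_fderiv (by fun_prop) (hk.of_le (by norm_num)) h0 _).fderiv]

lemma Aop_fderiv2 {N : ℕ} {F k : Euc N → ℝ} (hF : Continuous F) {δ : ℝ} (hδ : 0 < δ)
    (hk : ContDiff ℝ 2 k) (h0 : ∀ y, 1 < ‖y‖ → k y = 0) (x : Euc N) :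
    fderiv ℝ (fderiv ℝ (Aop F k δ)) x =
      δ⁻¹ • δ⁻¹ • Cv (fun z => F (δ • z)) (fderiv ℝ (fderiv ℝ k)) (δ⁻¹ • x) := by
  rw [Aop_fderiv hF hδ hk h0]
  have hk' : ContDiff ℝ 1 (fderiv ℝ k) := hk.fderiv_right (by norm_num)
  have h1 := Cv_fderiv (H := fun z => F (δ • z)) (by fun_prop) hk' (fderiv_zero_out h0) (δ⁻¹ • x)
  have h2 : HasFDerivAt (fun x : Euc N => δ⁻¹ • x) (δ⁻¹ • ContinuousLinearMap.id ℝ (Euc N)) x := by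
    exact (δ⁻¹ • ContinuousLinearMap.id ℝ (Euc N)).hasFDerivAt
  have h3 : fderiv ℝ (fun x => δ⁻¹ • Cv (fun z => F (δ • z)) (fderiv ℝ k) (δ⁻¹ • x)) x = _ :=
    ((h1.comp x h2).const_smul δ⁻¹).fderiv
  rw [h3]
  ext v w
  simp

lemma Aop_fderiv_bound {N : ℕ} {F k : Euc N → ℝ} (hF : Continuous F) {δ M : ℝ} (hδ : 0 < δ)
    (hM : ∀ y, |F y| ≤ M) (hk : ContDiff ℝ 2 k) (h0 : ∀ y, 1 < ‖y‖ → k y = 0) (x : Euc N) :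
    ‖fderiv ℝ (Aop F k δ) x‖ ≤ δ⁻¹ * (M * ∫ y, ‖fderiv ℝ k y‖) := by
  rw [Aop_fderiv hF hδ hk h0, norm_smul, Real.norm_eq_abs, abs_of_pos (inv_pos.2 hδ)]
  gcongr
  exact Cv_bound (fun y _ => hM _) (hk.continuous_fderiv (by norm_num)) (fderiv_zero_out h0)

lemma Aop_lip {N : ℕ} {F k : Euc N → ℝ} (hF : Continuous F) {δ M : ℝ} (hδ : 0 < δ)
    (hM : ∀ y, |F y| ≤ M) (hk : ContDiff ℝ 2 k) (h0 : ∀ y, 1 < ‖y‖ → k y = 0) (x x' : Euc N) :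
    |Aop F k δ x - Aop F k δ x'| ≤ δ⁻¹ * (M * ∫ y, ‖fderiv ℝ k y‖) * ‖x - x'‖ :=
  convex_univ.norm_image_sub_le_of_norm_fderiv_le
    (fun z _ => (Aop_contDiff hF hδ hk h0).differentiable (by norm_num) z)
    (fun z _ => Aop_fderiv_bound hF hδ hM hk h0 z) (mem_univ _) (mem_univ _)

lemma nsm {Z : Type*} [NormedAddCommGroup Z] [NormedSpace ℝ Z] {a : ℝ} (ha : 0 < a) (T : Z) :
    ‖a • T‖ = a * ‖T‖ := by
  rw [norm_smul, Real.norm_eq_abs, abs_of_pos ha]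

lemma nsm_le {Z : Type*} [NormedAddCommGroup Z] [NormedSpace ℝ Z] {a c : ℝ} (ha : 0 < a) {T : Z}
    (h : ‖T‖ ≤ c) : ‖a • T‖ ≤ a * c := by
  rw [nsm ha]; gcongr

lemma Aop_fderiv2_bound {N : ℕ} {F k : Euc N → ℝ} (hF : Continuous F) {δ A α : ℝ} (hδ : 0 < δ)
    (hα : 0 < α) (hA0 : 0 ≤ A)
    (hA : ∀ y z, |F y - F z| ≤ A * ‖y - z‖ ^ α) (hk : ContDiff ℝ 2 k) (h0 : ∀ y, 1 < ‖y‖ → k y = 0)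
    (x : Euc N) :
    ‖fderiv ℝ (fderiv ℝ (Aop F k δ)) x‖ ≤
      δ⁻¹ * (δ⁻¹ * ((A * δ ^ α) * ∫ y, ‖fderiv ℝ (fderiv ℝ k) y‖)) := by
  rw [Aop_fderiv2 hF hδ hk h0]
  refine nsm_le (Z := Euc N →L[ℝ] Euc N →L[ℝ] ℝ) (inv_pos.2 hδ)
    (nsm_le (Z := Euc N →L[ℝ] Euc N →L[ℝ] ℝ) (inv_pos.2 hδ) ?_)
  apply Cv_fderiv_bound (by fun_prop) _ (hk.fderiv_right (by norm_num)) (fderiv_zero_out h0)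
  intro y hy
  refine (hA _ _).trans ?_
  gcongr
  rw [← smul_sub, norm_smul, Real.norm_eq_abs, abs_of_pos hδ]
  have : ‖δ⁻¹ • x - y - δ⁻¹ • x‖ = ‖y‖ := by
    rw [sub_sub_cancel_left, norm_neg]
  rw [this]
  nlinarith [norm_nonneg y]

lemma Aop_half {N : ℕ} {F : Euc N → ℝ} (hN : 2 ≤ N) (hF : Continuous F) {δ : ℝ} (x : Euc N) :
    Aop F (etaf N) δ x - Aop F (etaf N) (δ / 2) x = Aop F (lap (Kf N)) δ x := by
  have h1 : Aop F (etaf N) (δ / 2) x = 2 ^ N * ∫ y, F (x - δ • y) * etaf N ((2:ℝ) • y) := by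
    have := Measure.integral_comp_smul (volume : Measure (Euc N))
      (fun y => F (x - (δ/2) • y) * etaf N y) 2
    unfold Aop
    simp only [smul_smul, div_mul_cancel₀ δ (two_ne_zero' ℝ), finrank_euclideanSpace,
      Fintype.card_fin, smul_eq_mul] at this
    rw [this, abs_of_pos (by positivity), ← mul_assoc, mul_inv_cancel₀ (by positivity), one_mul]
  have hc := (etaf_c2 N).continuous
  have h2 : Integrable (fun y => F (x - δ • y) * etaf N y) :=
    integrable_mul_cs (p := fun y => F (x - δ • y)) (by fun_prop) hc fun y => etaf_zero
  have h3 : Integrable (fun y => F (x - δ • y) * etaf N ((2:ℝ) • y)) :=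
    integrable_mul_cs (p := fun y => F (x - δ • y)) (by fun_prop) (by fun_prop) (fun y hy => etaf_zero (by
      rw [norm_smul]; norm_num; linarith))
  rw [h1, ← integral_const_mul]
  unfold Aop
  rw [← integral_sub h2 (h3.const_mul _)]
  congr 1
  funext y
  rw [Kf_lap hN]
  ring

/-- dyadic scales -/
def sc (δ : ℝ) (i : ℕ) : ℝ := δ * (1/2) ^ i

lemma sc_pos {δ : ℝ} (hδ : 0 < δ) (i : ℕ) : 0 < sc δ i := by unfold sc; positivity

lemma sc_le {δ : ℝ} (hδ : 0 < δ) (i : ℕ) : sc δ i ≤ δ := by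
  unfold sc
  have : (1/2 : ℝ) ^ i ≤ 1 := pow_le_one₀ (by norm_num) (by norm_num)
  nlinarith

lemma sc_succ (δ : ℝ) (i : ℕ) : sc δ (i+1) = sc δ i / 2 := by unfold sc; ring

lemma sc_hasSum (δ : ℝ) : HasSum (sc δ) (δ * 2) := hasSum_geometric_two.mul_left δ

lemma sc_zero (δ : ℝ) : sc δ 0 = δ := by simp [sc]

lemma sc_rpow_summable {δ α : ℝ} (hδ : 0 < δ) (hα : 0 < α) : Summable (fun i => sc δ i ^ α) := by
  have : (fun i => sc δ i ^ α) = fun i => δ ^ α * ((1/2:ℝ) ^ α) ^ i := by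
    funext i
    unfold sc
    rw [Real.mul_rpow hδ.le (by positivity), ← Real.rpow_natCast, ← Real.rpow_natCast,
      ← Real.rpow_mul (by norm_num), ← Real.rpow_mul (by norm_num), mul_comm (i:ℝ)]
  rw [this]
  apply Summable.mul_left
  apply summable_geometric_of_lt_one (by positivity)
  exact Real.rpow_lt_one (by norm_num) (by norm_num) hα

/-- terms of the expansion -/
def ht {N : ℕ} (F : Euc N → ℝ) (δ : ℝ) (i : ℕ) (x : Euc N) : ℝ :=
  (sc δ i) ^ 2 * Aop F (Kf N) (sc δ i) x

lemma ht_bound {N : ℕ} {F : Euc N → ℝ} {δ M : ℝ} (hδ : 0 < δ) (hM : ∀ y, |F y| ≤ M)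
    (i : ℕ) (x : Euc N) :
    |ht F δ i x| ≤ sc δ i * (δ * (M * ∫ y, ‖Kf N y‖)) := by
  unfold ht
  have h1 := Aop_bound (x := x) hM (sc_pos hδ i) (Kf_c2 N).continuous (fun y => Kf_zero)
  have h2 := sc_pos hδ i
  rw [abs_mul, abs_of_pos (by positivity), sq, mul_assoc]
  have h3 : 0 ≤ M := (abs_nonneg _).trans (hM 0)
  have h4 : 0 ≤ ∫ y, ‖Kf N y‖ := integral_nonneg fun y => norm_nonneg _
  gcongr
  exact sc_le hδ i

lemma ht_hasSum {N : ℕ} (hN : 2 ≤ N) {u F : Euc N → ℝ} {δ M : ℝ} (hδ : 0 < δ) (hu : Continuous u)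
    (hM : ∀ y, |F y| ≤ M) {x : Euc N}
    (hW : ∀ i, Aop u (lap (Kf N)) (sc δ i) x = ht F δ i x) :
    HasSum (fun i => ht F δ i x) (Aop u (etaf N) δ x - u x * ∫ y, etaf N y) := by
  have hs : Summable (fun i => ht F δ i x) :=
    Summable.of_norm_bounded ((sc_hasSum δ).summable.mul_right _) (fun i => ht_bound hδ hM i x)
  have hlim : Tendsto (fun n => Aop u (etaf N) (sc δ n) x) atTop (𝓝 (u x * ∫ y, etaf N y)) := by
    have h1 := (Aop_cont hu (etaf_c2 N).continuous (fun y => etaf_zero) x).tendsto 0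
    rw [Aop_zero] at h1
    exact h1.comp (sc_hasSum δ).summable.tendsto_atTop_zero
  have hsum : ∀ n, ∑ i ∈ Finset.range n, ht F δ i x
      = Aop u (etaf N) δ x - Aop u (etaf N) (sc δ n) x := by
    intro n
    have : ∀ i, ht F δ i x = Aop u (etaf N) (sc δ i) x - Aop u (etaf N) (sc δ (i+1)) x := by
      intro i
      rw [← hW, sc_succ, Aop_half hN hu]
    simp_rw [this]
    rw [Finset.sum_range_sub', sc_zero]
  have h2 := hs.hasSum.tendsto_sum_nat
  simp_rw [hsum] at h2
  have h3 := tendsto_nhds_unique h2 (hlim.const_sub _)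
  rw [← h3]
  exact hs.hasSum

lemma lip_core {N : ℕ} (hN : 2 ≤ N) {δ M : ℝ} (hδ : 0 < δ) : ∃ L : ℝ, 0 ≤ L ∧
    ∀ (u F : Euc N → ℝ), Continuous u → Continuous F → (∀ y, |u y| ≤ 1) → (∀ y, |F y| ≤ M) →
    ∀ x x', (∀ i, Aop u (lap (Kf N)) (sc δ i) x = ht F δ i x) →
      (∀ i, Aop u (lap (Kf N)) (sc δ i) x' = ht F δ i x') → |u x - u x'| ≤ L * ‖x - x'‖ := by
  set I := ∫ y, etaf N y with hI
  have hIpos : 0 < I := etaf_int_pos hN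
  set C1 := ∫ y, ‖fderiv ℝ (etaf N) y‖
  set C2 := ∫ y, ‖fderiv ℝ (Kf N) y‖
  have hC1 : 0 ≤ C1 := integral_nonneg fun y => norm_nonneg _
  have hC2 : 0 ≤ C2 := integral_nonneg fun y => norm_nonneg _
  refine ⟨(δ⁻¹ * C1 + δ * 2 * (|M| * C2)) / I, by positivity, ?_⟩
  intro u F hu hF hu1 hM x x' hx hx'
  have hM' : ∀ y, |F y| ≤ |M| := fun y => (hM y).trans (le_abs_self M)
  have h1 := (ht_hasSum hN hδ hu hM hx).sub (ht_hasSum hN hδ hu hM hx')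
  have h2 : ∀ i, ‖ht F δ i x - ht F δ i x'‖ ≤ sc δ i * ((|M| * C2) * ‖x - x'‖) := by
    intro i
    unfold ht
    have h3 := Aop_lip hF (sc_pos hδ i) hM' (Kf_c2 N) (fun y => Kf_zero) x x'
    have hp := sc_pos hδ i
    rw [← mul_sub, Real.norm_eq_abs, abs_mul, abs_of_pos (by positivity)]
    calc _ ≤ sc δ i ^ 2 * ((sc δ i)⁻¹ * (|M| * C2) * ‖x - x'‖) := by gcongr
      _ = _ := by field_simp
  have h4 := h1.norm_le_of_bounded ((sc_hasSum δ).mul_right _) h2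
  have h5 := Aop_lip hu hδ hu1 (etaf_c2 N) (fun y => etaf_zero) x x'
  rw [div_mul_eq_mul_div, le_div_iff₀ hIpos]
  have h6 : |u x - u x'| * I = |(Aop u (etaf N) δ x - Aop u (etaf N) δ x')
      - ((Aop u (etaf N) δ x - u x * I) - (Aop u (etaf N) δ x' - u x' * I))| := by
    rw [show (Aop u (etaf N) δ x - Aop u (etaf N) δ x')
      - ((Aop u (etaf N) δ x - u x * I) - (Aop u (etaf N) δ x' - u x' * I)) = (u x - u x') * I by ring,
      abs_mul, abs_of_pos hIpos]
  rw [h6]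
  refine (abs_sub _ _).trans ?_
  rw [one_mul] at h5
  rw [Real.norm_eq_abs] at h4
  calc _ ≤ δ⁻¹ * C1 * ‖x - x'‖ + δ * 2 * ((|M| * C2) * ‖x - x'‖) := add_le_add h5 h4
    _ = _ := by ring

lemma c2_core {N : ℕ} (hN : 2 ≤ N) {δ M A α : ℝ} (hδ : 0 < δ) (hα : 0 < α) (hA0 : 0 ≤ A)
    {u F : Euc N → ℝ} (hu : Continuous u) (hF : Continuous F) (hM : ∀ y, |F y| ≤ M)
    (hA : ∀ y z, |F y - F z| ≤ A * ‖y - z‖ ^ α) {S : Set (Euc N)}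
    (hW : ∀ x ∈ S, ∀ i, Aop u (lap (Kf N)) (sc δ i) x = ht F δ i x) : ContDiffOn ℝ 2 u S := by
  set I := ∫ y, etaf N y with hI
  have hIpos : 0 < I := etaf_int_pos hN
  have hKz : ∀ y : Euc N, 1 < ‖y‖ → Kf N y = 0 := fun y => Kf_zero
  have hcd : ∀ i, ContDiff ℝ 2 (ht F δ i) := fun i =>
    contDiff_const.mul (Aop_contDiff hF (sc_pos hδ i) (Kf_c2 N) hKz)
  set C0 := ∫ y, ‖Kf N y‖
  set C1 := ∫ y, ‖fderiv ℝ (Kf N) y‖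
  set C2 := ∫ y, ‖fderiv ℝ (fderiv ℝ (Kf N)) y‖
  have e1 : ∀ i, fderiv ℝ (ht F δ i) = fun x => sc δ i ^ 2 • fderiv ℝ (Aop F (Kf N) (sc δ i)) x := by
    intro i; funext x
    have h := (Aop_contDiff hF (sc_pos hδ i) (Kf_c2 N) hKz).differentiable (by norm_num) x
    exact (h.hasFDerivAt.const_mul _).fderiv
  have e2 : ∀ i x, fderiv ℝ (fderiv ℝ (ht F δ i)) x =
      sc δ i ^ 2 • fderiv ℝ (fderiv ℝ (Aop F (Kf N) (sc δ i))) x := by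
    intro i x
    rw [e1]
    have h := c2_fderiv_diff (Aop_contDiff hF (sc_pos hδ i) (Kf_c2 N) hKz).contDiffAt (x := x)
    exact (h.hasFDerivAt.const_smul (sc δ i ^ 2)).fderiv
  have hsumC : ContDiff ℝ 2 (fun x => ∑' i, ht F δ i x) := by
    refine contDiff_tsum (N := 2) (v := fun k i => if k = 0 then sc δ i * (δ * (M * C0)) else
      if k = 1 then sc δ i * (M * C1) else sc δ i ^ α * (A * C2)) hcd ?_ ?_
    · intro k hk
      have hk2 : k ≤ 2 := by exact_mod_cast hk
      interval_cases k
      · simpa using (sc_hasSum δ).summable.mul_right _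
      · simpa using (sc_hasSum δ).summable.mul_right _
      · simpa using (sc_rpow_summable hδ hα).mul_right _
    · intro k i x hk
      have hk2 : k ≤ 2 := by exact_mod_cast hk
      have hp := sc_pos hδ i
      interval_cases k
      · rw [norm_iteratedFDeriv_zero]; simp only [↓reduceIte]; exact ht_bound hδ hM i x
      · rw [← norm_iteratedFDeriv_fderiv, norm_iteratedFDeriv_zero, e1, norm_smul, Real.norm_eq_abs,
          abs_of_pos (by positivity)]
        calc _ ≤ sc δ i ^ 2 * ((sc δ i)⁻¹ * (M * C1)) := by
              gcongr
              exact Aop_fderiv_bound hF hp hM (Kf_c2 N) hKz x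
          _ = sc δ i * (M * C1) := by field_simp
          _ ≤ _ := by simp
      · rw [← norm_iteratedFDeriv_fderiv, ← norm_iteratedFDeriv_fderiv, norm_iteratedFDeriv_zero,
          e2]
        calc _ ≤ sc δ i ^ 2 * ((sc δ i)⁻¹ * ((sc δ i)⁻¹ * ((A * (sc δ i) ^ α) * C2))) := by
              refine nsm_le (Z := Euc N →L[ℝ] Euc N →L[ℝ] ℝ) (by positivity) ?_
              exact Aop_fderiv2_bound hF hp hα hA0 hA (Kf_c2 N) hKz x
          _ = sc δ i ^ α * (A * C2) := by field_simp
          _ ≤ _ := by simp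
  have hmain : ContDiff ℝ 2 (fun x => I⁻¹ * (Aop u (etaf N) δ x - ∑' i, ht F δ i x)) :=
    contDiff_const.mul ((Aop_contDiff hu hδ (etaf_c2 N) (fun y => etaf_zero)).sub hsumC)
  refine hmain.contDiffOn.congr ?_
  intro x hx
  rw [(ht_hasSum hN hδ hu hM (hW x hx)).tsum_eq]
  field_simp
  ring

lemma retract {N : ℕ} (x0 : Euc N) {r : ℝ} (hr : 0 < r) : ∃ P : Euc N → Euc N, ∃ K : NNReal,
    LipschitzWith K P ∧ (∀ x ∈ closedBall x0 r, P x = x) ∧ ∀ x, P x ∈ closedBall x0 (2 * r) := by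
  let χ : ContDiffBump x0 := ⟨r, 2 * r, hr, by linarith⟩
  have hcd : ContDiff ℝ 1 (fun x => χ x • (x - x0)) :=
    (χ.contDiff (n := 1)).smul (by fun_prop)
  have hcs : HasCompactSupport (fun x => χ x • (x - x0)) := χ.hasCompactSupport.smul_right
  obtain ⟨K, hK⟩ := hcd.lipschitzWith_of_hasCompactSupport hcs (by norm_num)
  refine ⟨fun x => x0 + χ x • (x - x0), K, ?_, ?_, ?_⟩
  · intro x y
    rw [edist_add_left]
    exact hK x y
  · intro x hx
    have : χ x = 1 := χ.one_of_mem_closedBall hx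
    simp [this]
  · intro x
    rw [mem_closedBall, dist_eq_norm, add_sub_cancel_left, norm_smul, Real.norm_eq_abs,
      abs_of_nonneg χ.nonneg]
    by_cases h : 2 * r ≤ dist x x0
    · have : χ x = 0 := χ.zero_of_le_dist h
      rw [this]; linarith
    · push Not at h
      rw [dist_eq_norm] at h
      have := χ.le_one (x := x)
      have := χ.nonneg (x := x)
      nlinarith [norm_nonneg (x - x0)]

lemma lapK_zero {N : ℕ} (hN : 2 ≤ N) (y : Euc N) (hy : 1 < ‖y‖) : lap (Kf N) y = 0 := by
  rw [Kf_lap hN, etaf_zero hy, etaf_zero (by rw [norm_smul]; norm_num; linarith)]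
  simp

lemma lapK_cont {N : ℕ} : Continuous (lap (Kf N)) := by
  rw [← continuousOn_univ]
  exact lap_cont isOpen_univ (Kf_c2 N).contDiffOn

lemma Aop_congr {N : ℕ} {F G k : Euc N → ℝ} (h0 : ∀ y, 1 < ‖y‖ → k y = 0) {x : Euc N} {c : ℝ}
    (hc : 0 < c) (h : ∀ z ∈ closedBall x c, F z = G z) : Aop F k c x = Aop G k c x := by
  unfold Aop
  congr 1
  funext y
  by_cases hy : 1 < ‖y‖
  · simp [h0 y hy]
  · rw [h]
    rw [mem_closedBall, dist_eq_norm, sub_sub_cancel_left, norm_neg, norm_smul, Real.norm_eq_abs,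
      abs_of_pos hc]
    push Not at hy
    nlinarith

lemma local_id {N : ℕ} (hN : 2 ≤ N) {Ω : Set (Euc N)} (hΩ : IsOpen Ω) {w : Euc N → ℝ}
    (hw : ContDiffOn ℝ 2 w Ω) {x0 : Euc N} {r : ℝ} (hr : 0 < r) (hs : closedBall x0 (2 * r) ⊆ Ω)
    {P : Euc N → Euc N} (hP : ∀ x ∈ closedBall x0 r, P x = x) {x : Euc N} (hx : x ∈ ball x0 (r / 2))
    (i : ℕ) : Aop (fun z => w (P z)) (lap (Kf N)) (sc (r / 4) i) x
      = ht (fun z => lap w (P z)) (r / 4) i x := by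
  have hc := sc_pos (show 0 < r / 4 by positivity) i
  have hc2 := sc_le (show 0 < r / 4 by positivity) i
  rw [mem_ball] at hx
  have hid : ∀ z ∈ closedBall x (sc (r / 4) i), P z = z := by
    intro z hz
    apply hP
    rw [mem_closedBall] at *
    linarith [dist_triangle z x x0]
  rw [Aop_congr (lapK_zero hN) hc (G := w) (fun z hz => by rw [hid z hz])]
  unfold ht
  rw [Aop_congr (fun y => Kf_zero) hc (G := lap w) (fun z hz => by rw [hid z hz])]
  apply ibp hΩ hw (Kf_c2 N) (fun y => Kf_zero) hc
  intro z hz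
  apply hs
  rw [mem_closedBall]
  rw [mem_ball] at hz
  linarith [dist_triangle z x x0]

lemma Aop_lim {N : ℕ} {w : ℕ → Euc N → ℝ} {W k : Euc N → ℝ} {M : ℝ} (hw : ∀ n, Continuous (w n))
    (hM : ∀ n y, |w n y| ≤ M) (hlim : ∀ y, Tendsto (fun n => w n y) atTop (𝓝 (W y)))
    (hk : Continuous k) (h0 : ∀ y, 1 < ‖y‖ → k y = 0) (c : ℝ) (x : Euc N) :
    Tendsto (fun n => Aop (w n) k c x) atTop (𝓝 (Aop W k c x)) := by
  unfold Aop
  apply tendsto_integral_of_dominated_convergence (fun y => M * ‖k y‖)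
  · intro n
    have := hw n
    exact Continuous.aestronglyMeasurable (by fun_prop)
  · exact integrable_mul_cs (p := fun _ => M) (k := fun y => ‖k y‖) continuousOn_const hk.norm
      (fun y hy => by simp [h0 y hy])
  · intro n
    refine Eventually.of_forall fun y => ?_
    rw [norm_mul]
    gcongr
    exact hM n _
  · exact Eventually.of_forall fun y => (hlim _).mul_const _

lemma local_lim {N : ℕ} (hN : 2 ≤ N) {Ω : Set (Euc N)} (hΩ : IsOpen Ω) {w : ℕ → Euc N → ℝ}
    {W F : Euc N → ℝ} {M : ℝ}
    (hw : ∀ n, ContDiffOn ℝ 2 (w n) Ω) (hw1 : ∀ n, ∀ x ∈ Ω, |w n x| ≤ 1)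
    (hwM : ∀ n, ∀ x ∈ Ω, |lap (w n) x| ≤ M)
    (hW : ∀ x ∈ Ω, Tendsto (fun n => w n x) atTop (𝓝 (W x)))
    (hF : ∀ x ∈ Ω, Tendsto (fun n => lap (w n) x) atTop (𝓝 (F x)))
    {x0 : Euc N} {r : ℝ} (hr : 0 < r) (hs : closedBall x0 (2 * r) ⊆ Ω)
    {P : Euc N → Euc N} (hPc : Continuous P) (hP : ∀ x ∈ closedBall x0 r, P x = x)
    (hP2 : ∀ x, P x ∈ closedBall x0 (2 * r)) {x : Euc N} (hx : x ∈ ball x0 (r / 2))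
    (i : ℕ) : Aop (fun z => W (P z)) (lap (Kf N)) (sc (r / 4) i) x
      = ht (fun z => F (P z)) (r / 4) i x := by
  have hPΩ : ∀ x, P x ∈ Ω := fun x => hs (hP2 x)
  have h1 := Aop_lim (w := fun n z => w n (P z)) (W := fun z => W (P z)) (M := 1)
    (fun n => (hw n).continuousOn.comp_continuous hPc hPΩ) (fun n y => hw1 n _ (hPΩ y))
    (fun y => hW _ (hPΩ y)) lapK_cont (lapK_zero hN) (sc (r / 4) i) x
  have h2 := Aop_lim (w := fun n z => lap (w n) (P z)) (W := fun z => F (P z)) (M := M)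
    (fun n => (lap_cont hΩ (hw n)).comp_continuous hPc hPΩ) (fun n y => hwM n _ (hPΩ y))
    (fun y => hF _ (hPΩ y)) (Kf_c2 N).continuous (fun y => Kf_zero) (sc (r / 4) i) x
  refine tendsto_nhds_unique h1 ?_
  simp_rw [local_id hN hΩ (hw _) hr hs hP hx i]
  exact h2.const_mul _

lemma lim_lip {N : ℕ} (hN : 2 ≤ N) {Ω : Set (Euc N)} (hΩ : IsOpen Ω) {w : ℕ → Euc N → ℝ}
    {W : Euc N → ℝ} {M : ℝ}
    (hw : ∀ n, ContDiffOn ℝ 2 (w n) Ω) (hw1 : ∀ n, ∀ x ∈ Ω, |w n x| ≤ 1)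
    (hwM : ∀ n, ∀ x ∈ Ω, |lap (w n) x| ≤ M)
    (hW : ∀ x ∈ Ω, Tendsto (fun n => w n x) atTop (𝓝 (W x))) {x0 : Euc N} (hx0 : x0 ∈ Ω) :
    ∃ ρ > 0, ∃ L : ℝ, 0 ≤ L ∧ ∀ x ∈ ball x0 ρ, ∀ x' ∈ ball x0 ρ, |W x - W x'| ≤ L * ‖x - x'‖ := by
  obtain ⟨R, hR, hRs⟩ := nhds_basis_closedBall.mem_iff.1 (hΩ.mem_nhds hx0)
  set r := R / 2 with hr_def
  have hr : 0 < r := by positivity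
  have hs : closedBall x0 (2 * r) ⊆ Ω := by rwa [hr_def, mul_div_cancel₀ _ two_ne_zero]
  obtain ⟨P, K, hPl, hP, hP2⟩ := retract x0 hr
  have hPΩ : ∀ x, P x ∈ Ω := fun x => hs (hP2 x)
  obtain ⟨L, hL0, hL⟩ := lip_core (M := M) hN (show 0 < r / 4 by positivity)
  refine ⟨r / 2, by positivity, L, hL0, ?_⟩
  intro x hx x' hx'
  have hxb : ∀ z ∈ ball x0 (r / 2), z ∈ closedBall x0 r := fun z hz =>
    ball_subset_closedBall (ball_subset_ball (by linarith) hz)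
  have key : ∀ n, |w n x - w n x'| ≤ L * ‖x - x'‖ := by
    intro n
    have := hL (fun z => w n (P z)) (fun z => lap (w n) (P z))
      ((hw n).continuousOn.comp_continuous hPl.continuous hPΩ)
      ((lap_cont hΩ (hw n)).comp_continuous hPl.continuous hPΩ)
      (fun y => hw1 n _ (hPΩ y)) (fun y => hwM n _ (hPΩ y)) x x'
      (local_id hN hΩ (hw n) hr hs hP hx) (local_id hN hΩ (hw n) hr hs hP hx')
    simpa only [hP x (hxb x hx), hP x' (hxb x' hx')] using this
  have hxΩ : ∀ z ∈ ball x0 (r / 2), z ∈ Ω := fun z hz =>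
    hs (closedBall_subset_closedBall (by linarith) (hxb z hz))
  exact le_of_tendsto ((hW x (hxΩ x hx)).sub (hW x' (hxΩ x' hx'))).abs (Eventually.of_forall key)

lemma lim_c2 {N : ℕ} (hN : 2 ≤ N) {Ω : Set (Euc N)} (hΩ : IsOpen Ω) {w : ℕ → Euc N → ℝ}
    {W F : Euc N → ℝ} {M : ℝ}
    (hw : ∀ n, ContDiffOn ℝ 2 (w n) Ω) (hw1 : ∀ n, ∀ x ∈ Ω, |w n x| ≤ 1)
    (hwM : ∀ n, ∀ x ∈ Ω, |lap (w n) x| ≤ M)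
    (hW : ∀ x ∈ Ω, Tendsto (fun n => w n x) atTop (𝓝 (W x)))
    (hF : ∀ x ∈ Ω, Tendsto (fun n => lap (w n) x) atTop (𝓝 (F x)))
    (hWc : ContinuousOn W Ω) (hFc : ContinuousOn F Ω)
    {x0 : Euc N} (hx0 : x0 ∈ Ω)
    (hH : ∃ ρ > 0, ∃ A α : ℝ, 0 ≤ A ∧ 0 < α ∧ ∀ x ∈ ball x0 ρ, ∀ x' ∈ ball x0 ρ,
      |F x - F x'| ≤ A * ‖x - x'‖ ^ α) :
    ContDiffAt ℝ 2 W x0 ∧ lap W x0 = F x0 := by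
  obtain ⟨ρ, hρ, A, α, hA0, hα, hA⟩ := hH
  obtain ⟨R, hR, hRs⟩ := nhds_basis_closedBall.mem_iff.1
    (inter_mem (hΩ.mem_nhds hx0) (ball_mem_nhds x0 hρ))
  set r := R / 2 with hr_def
  have hr : 0 < r := by positivity
  have hs' : closedBall x0 (2 * r) ⊆ Ω ∩ ball x0 ρ := by
    rwa [hr_def, mul_div_cancel₀ _ two_ne_zero]
  have hs : closedBall x0 (2 * r) ⊆ Ω := fun z hz => (hs' hz).1
  have hFM : ∀ x ∈ Ω, |F x| ≤ M := fun x hx =>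
    le_of_tendsto (hF x hx).abs (Eventually.of_forall fun n => hwM n x hx)
  have hC2 : ContDiffOn ℝ 2 W (ball x0 (r / 2)) := by
    obtain ⟨P, K, hPl, hP, hP2⟩ := retract x0 hr
    have hPΩ : ∀ x, P x ∈ Ω := fun x => hs (hP2 x)
    have h := c2_core (M := M) (A := A * (K:ℝ) ^ α) (α := α) (u := fun z => W (P z))
      (F := fun z => F (P z)) (S := ball x0 (r / 2)) hN (show 0 < r / 4 by positivity) hα
      (by positivity) (hWc.comp_continuous hPl.continuous hPΩ)
      (hFc.comp_continuous hPl.continuous hPΩ) (fun y => hFM _ (hPΩ y)) ?_ ?_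
    · refine h.congr fun x hx => ?_
      rw [hP x (ball_subset_closedBall (ball_subset_ball (by linarith) hx))]
    · intro y z
      refine (hA _ (hs' (hP2 y)).2 _ (hs' (hP2 z)).2).trans ?_
      rw [mul_assoc, ← Real.mul_rpow (by positivity) (by positivity)]
      gcongr
      rw [← dist_eq_norm, ← dist_eq_norm]
      exact hPl.dist_le_mul y z
    · intro x hx i
      exact local_lim hN hΩ hw hw1 hwM hW hF hr hs hPl.continuous hP hP2 hx i
  refine ⟨hC2.contDiffAt (ball_mem_nhds _ (by positivity)), ?_⟩
  have hr' : 0 < r / 8 := by positivity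
  obtain ⟨P, K, hPl, hP, hP2⟩ := retract x0 hr'
  have hsb : closedBall x0 (2 * (r / 8)) ⊆ ball x0 (r / 2) := closedBall_subset_ball (by linarith)
  have hsΩ : closedBall x0 (2 * (r / 8)) ⊆ Ω := fun z hz =>
    hs (closedBall_subset_closedBall (by linarith) hz)
  have hx : x0 ∈ ball x0 (r / 8 / 2) := mem_ball_self (by positivity)
  have hPx : P x0 = x0 := hP x0 (mem_closedBall_self hr'.le)
  have e : ∀ i, Aop (fun z => lap W (P z)) (Kf N) (sc (r / 8 / 4) i) x0
      = Aop (fun z => F (P z)) (Kf N) (sc (r / 8 / 4) i) x0 := by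
    intro i
    have e1 := local_lim hN hΩ hw hw1 hwM hW hF hr' hsΩ hPl.continuous hP hP2 hx i
    have e2 := local_id hN isOpen_ball hC2 hr' hsb hP hx i
    rw [e1] at e2
    unfold ht at e2
    have := sc_pos (show 0 < r / 8 / 4 by positivity) i
    exact (mul_left_cancel₀ (by positivity) e2).symm
  have hsc : Tendsto (sc (r / 8 / 4)) atTop (𝓝 0) := (sc_hasSum _).summable.tendsto_atTop_zero
  have t1 := ((Aop_cont (F := fun z => lap W (P z))
    ((lap_cont isOpen_ball hC2).comp_continuous hPl.continuous (fun x => hsb (hP2 x)))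
    (Kf_c2 N).continuous (fun y => Kf_zero) x0).tendsto 0).comp hsc
  have t2 := ((Aop_cont (F := fun z => F (P z))
    (hFc.comp_continuous hPl.continuous (fun x => hsΩ (hP2 x)))
    (Kf_c2 N).continuous (fun y => Kf_zero) x0).tendsto 0).comp hsc
  have t3 := tendsto_nhds_unique (t1.congr e) t2
  rw [Aop_zero, Aop_zero, hPx] at t3
  exact mul_right_cancel₀ (Kf_int_pos N).ne' t3

lemma mono_rhs {c a b : ℝ} (hc : 0 ≤ c) (hab : a ≤ b) (hb : b < 1) :
    c / (1 - a) ^ 2 ≤ c / (1 - b) ^ 2 := by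
  have : 0 < 1 - b := by linarith
  gcongr

lemma exists_max {N : ℕ} {Ω : Set (Euc N)} (hΩ : IsBddDomain Ω) {u : Euc N → ℝ}
    (hc : ContinuousOn u (closure Ω)) (hr : ∀ x ∈ Ω, 0 ≤ u x ∧ u x < 1)
    (hb : ∀ x ∈ frontier Ω, u x = 0) : ∃ m, 0 ≤ m ∧ m < 1 ∧ ∀ x ∈ Ω, u x ≤ m := by
  obtain ⟨z, hz, hm⟩ := hΩ.2.1.isCompact_closure.exists_isMaxOn hΩ.2.2.closure hc
  obtain ⟨p, hp⟩ := hΩ.2.2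
  refine ⟨u z, (hr p hp).1.trans (hm (subset_closure hp)), ?_, fun x hx => hm (subset_closure hx)⟩
  rw [closure_eq_self_union_frontier] at hz
  rcases hz with hz | hz
  · exact (hr z hz).2
  · rw [hb z hz]; norm_num

lemma lap_zero' {N : ℕ} (x : Euc N) : lap (fun _ : Euc N => (0:ℝ)) x = 0 := by
  simp [lap, secondDerivCoord]

lemma conv {N : ℕ} (hN : 2 ≤ N) {Ω : Set (Euc N)} (hΩ : IsBddDomain Ω) {w : ℕ → Euc N → ℝ}
    {us : Euc N → ℝ} {M : ℝ} (husc : ContinuousOn us (closure Ω))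
    (husb : ∀ x ∈ frontier Ω, us x = 0) (hus1 : ∀ x ∈ Ω, us x < 1)
    (hw : ∀ n, ContDiffOn ℝ 2 (w n) Ω) (hwc : ∀ n, ContinuousOn (w n) (closure Ω))
    (hwb : ∀ n, ∀ x ∈ frontier Ω, w n x = 0) (hw0 : ∀ n, ∀ x ∈ Ω, 0 ≤ w n x)
    (hwus : ∀ n, ∀ x ∈ Ω, w n x ≤ us x) (hwM : ∀ n, ∀ x ∈ Ω, |lap (w n) x| ≤ M)
    (hmono : ∀ x ∈ Ω, Monotone fun n => w n x) :
    ∃ W : Euc N → ℝ, (∀ x ∈ Ω, Tendsto (fun n => w n x) atTop (𝓝 (W x))) ∧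
      (∀ x0 ∈ Ω, ∃ ρ > 0, ∃ L : ℝ, 0 ≤ L ∧ ∀ x ∈ ball x0 ρ, ∀ x' ∈ ball x0 ρ,
        |W x - W x'| ≤ L * ‖x - x'‖) ∧
      ContinuousOn W (closure Ω) ∧ TendstoUniformlyOn w W atTop Ω ∧
      (∀ x ∈ frontier Ω, W x = 0) ∧ (∀ x ∈ Ω, 0 ≤ W x) := by
  have hcl : ∀ x ∈ closure Ω, x ∈ Ω ∨ x ∈ frontier Ω := fun x hx => by
    rwa [closure_eq_self_union_frontier] at hx
  have hmono' : ∀ x ∈ closure Ω, Monotone fun n => w n x := by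
    intro x hx
    rcases hcl x hx with h | h
    · exact hmono x h
    · intro a b _
      simp [hwb _ x h]
  have hwus' : ∀ n, ∀ x ∈ closure Ω, w n x ≤ us x := by
    intro n x hx
    rcases hcl x hx with h | h
    · exact hwus n x h
    · simp [hwb _ x h, husb x h]
  have hw0' : ∀ n, ∀ x ∈ closure Ω, 0 ≤ w n x := by
    intro n x hx
    rcases hcl x hx with h | h
    · exact hw0 n x h
    · simp [hwb _ x h]
  set W : Euc N → ℝ := fun x => ⨆ n, w n x with hWdef
  have ht : ∀ x ∈ closure Ω, Tendsto (fun n => w n x) atTop (𝓝 (W x)) := by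
    intro x hx
    apply tendsto_atTop_ciSup (hmono' x hx)
    refine ⟨us x, ?_⟩
    rintro _ ⟨n, rfl⟩
    exact hwus' n x hx
  have hW0 : ∀ x ∈ closure Ω, 0 ≤ W x := fun x hx =>
    ge_of_tendsto' (ht x hx) fun n => hw0' n x hx
  have hWus : ∀ x ∈ closure Ω, W x ≤ us x := fun x hx =>
    le_of_tendsto' (ht x hx) fun n => hwus' n x hx
  have hWb : ∀ x ∈ frontier Ω, W x = 0 := fun x hx => by simp [hWdef, hwb _ x hx]
  have hlip : ∀ x0 ∈ Ω, ∃ ρ > 0, ∃ L : ℝ, 0 ≤ L ∧ ∀ x ∈ ball x0 ρ, ∀ x' ∈ ball x0 ρ,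
        |W x - W x'| ≤ L * ‖x - x'‖ := by
    intro x0 hx0
    refine lim_lip hN hΩ.1 hw ?_ hwM (fun x hx => ht x (subset_closure hx)) hx0
    intro n x hx
    rw [abs_of_nonneg (hw0 n x hx)]
    exact (hwus n x hx).trans (hus1 x hx).le
  have hWc : ContinuousOn W (closure Ω) := by
    intro x0 hx0
    rcases hcl x0 hx0 with h | h
    · apply ContinuousAt.continuousWithinAt
      obtain ⟨ρ, hρ, L, hL, hl⟩ := hlip x0 h
      rw [ContinuousAt, tendsto_iff_norm_sub_tendsto_zero]
      have hz : Tendsto (fun x => L * ‖x - x0‖) (𝓝 x0) (𝓝 0) := by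
        have : Continuous (fun x => L * ‖x - x0‖) := by fun_prop
        simpa using this.tendsto x0
      refine squeeze_zero' (Eventually.of_forall fun x => norm_nonneg _) ?_ hz
      filter_upwards [ball_mem_nhds x0 hρ] with x hx
      exact hl x hx x0 (mem_ball_self hρ)
    · have h1 := husc x0 hx0
      rw [ContinuousWithinAt, husb x0 h] at h1
      rw [ContinuousWithinAt, hWb x0 h]
      refine squeeze_zero' ?_ ?_ h1
      · filter_upwards [self_mem_nhdsWithin] with x hx using hW0 x hx
      · filter_upwards [self_mem_nhdsWithin] with x hx using hWus x hx
  refine ⟨W, fun x hx => ht x (subset_closure hx), hlip, hWc, ?_, hWb,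
    fun x hx => hW0 x (subset_closure hx)⟩
  exact (Monotone.tendstoUniformlyOn_of_forall_tendsto hΩ.2.1.isCompact_closure hwc hmono' hWc
    ht).mono subset_closure

lemma inv_sq_lip {m a b : ℝ} (hm : m < 1) (ha0 : 0 ≤ a) (hb0 : 0 ≤ b) (ha : a ≤ m) (hb : b ≤ m) :
    |1 / (1 - a) ^ 2 - 1 / (1 - b) ^ 2| ≤ 2 / (1 - m) ^ 4 * |a - b| := by
  have hc : 0 < 1 - m := by linarith
  have h1 : 0 < 1 - a := by linarith
  have h2 : 0 < 1 - b := by linarith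
  have e : 1 / (1 - a) ^ 2 - 1 / (1 - b) ^ 2
      = ((1 - a) + (1 - b)) / ((1 - a) ^ 2 * (1 - b) ^ 2) * (a - b) := by
    field_simp; ring
  rw [e, abs_mul, abs_of_pos (by positivity)]
  have : (1 - m) ^ 4 ≤ (1 - a) ^ 2 * (1 - b) ^ 2 := by
    calc (1 - m) ^ 4 = (1 - m) ^ 2 * (1 - m) ^ 2 := by ring
      _ ≤ _ := by gcongr
  gcongr
  linarith

lemma rhs_holder {N : ℕ} {Ω : Set (Euc N)} (hΩ : IsOpen Ω) {f Z : Euc N → ℝ} (hf : HypH Ω f)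
    {lam m : ℝ} (hlam : 0 < lam) (hm : m < 1) (hZ0 : ∀ x ∈ Ω, 0 ≤ Z x) (hZm : ∀ x ∈ Ω, Z x ≤ m)
    {x0 : Euc N} (hx0 : x0 ∈ Ω)
    (hlip : ∃ ρ > 0, ∃ L : ℝ, 0 ≤ L ∧ ∀ x ∈ ball x0 ρ, ∀ x' ∈ ball x0 ρ,
        |Z x - Z x'| ≤ L * ‖x - x'‖) :
    ∃ ρ > 0, ∃ A α : ℝ, 0 ≤ A ∧ 0 < α ∧ ∀ x ∈ ball x0 ρ, ∀ x' ∈ ball x0 ρ,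
      |-(lam * f x / (1 - Z x) ^ 2) - -(lam * f x' / (1 - Z x') ^ 2)| ≤ A * ‖x - x'‖ ^ α := by
  obtain ⟨⟨α, hα0, hα1, C, hC⟩, hf01, -⟩ := hf
  obtain ⟨ρ1, hρ1, L, hL, hl⟩ := hlip
  obtain ⟨ρ2, hρ2, hb⟩ := Metric.isOpen_iff.1 hΩ x0 hx0
  have hc : 0 < 1 - m := by linarith
  refine ⟨min (min ρ1 ρ2) (1/2), by positivity,
    lam * (C * (1 / (1 - m) ^ 2) + 2 / (1 - m) ^ 4 * L), α, by positivity, by exact_mod_cast hα0, ?_⟩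
  intro x hx x' hx'
  have b1 : ∀ z ∈ ball x0 (min (min ρ1 ρ2) (1/2)), z ∈ ball x0 ρ1 := fun z hz =>
    ball_subset_ball ((min_le_left _ _).trans (min_le_left _ _)) hz
  have b2 : ∀ z ∈ ball x0 (min (min ρ1 ρ2) (1/2)), z ∈ Ω := fun z hz =>
    hb (ball_subset_ball ((min_le_left _ _).trans (min_le_right _ _)) hz)
  have b3 : ∀ z ∈ ball x0 (min (min ρ1 ρ2) (1/2)), dist z x0 < 1/2 := fun z hz =>
    ball_subset_ball (min_le_right _ _) hz
  have hd : ‖x - x'‖ ≤ 1 := by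
    rw [← dist_eq_norm]
    have := dist_triangle_right x x' x0
    linarith [b3 x hx, b3 x' hx']
  have hpow : ‖x - x'‖ ≤ ‖x - x'‖ ^ (α:ℝ) := by
    calc ‖x - x'‖ = ‖x - x'‖ ^ (1:ℝ) := (Real.rpow_one _).symm
      _ ≤ _ := Real.rpow_le_rpow_of_exponent_ge_of_imp (norm_nonneg _) hd (by exact_mod_cast hα1)
          (fun _ h => absurd h (by norm_num))
  have h1 := hC.dist_le (subset_closure (b2 x hx)) (subset_closure (b2 x' hx'))
  rw [Real.dist_eq, dist_eq_norm] at h1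
  have h2 := inv_sq_lip hm (hZ0 x (b2 x hx)) (hZ0 x' (b2 x' hx')) (hZm x (b2 x hx)) (hZm x' (b2 x' hx'))
  have h3 := (hl x (b1 x hx) x' (b1 x' hx'))
  have h4 := hf01 x' (subset_closure (b2 x' hx'))
  have h5 : 0 < 1 / (1 - Z x) ^ 2 ∧ 1 / (1 - Z x) ^ 2 ≤ 1 / (1 - m) ^ 2 := by
    have : 0 < 1 - Z x := by linarith [hZm x (b2 x hx)]
    exact ⟨by positivity, mono_rhs zero_le_one (hZm x (b2 x hx)) hm⟩
  have e : -(lam * f x / (1 - Z x) ^ 2) - -(lam * f x' / (1 - Z x') ^ 2)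
      = -(lam * ((f x - f x') * (1 / (1 - Z x) ^ 2)
        + f x' * (1 / (1 - Z x) ^ 2 - 1 / (1 - Z x') ^ 2))) := by ring
  rw [e, abs_neg, abs_mul, abs_of_pos hlam, mul_assoc]
  gcongr
  refine (abs_add_le _ _).trans ?_
  rw [abs_mul, abs_mul, abs_of_pos h5.1, abs_of_nonneg h4.1, add_mul]
  apply add_le_add
  · calc _ ≤ C * ‖x - x'‖ ^ (α:ℝ) * (1 / (1 - m) ^ 2) := mul_le_mul h1 h5.2 h5.1.le (by positivity)
      _ = _ := by ring
  · calc _ ≤ 1 * (2 / (1 - m) ^ 4 * |Z x - Z x'|) := mul_le_mul h4.2 h2 (abs_nonneg _) zero_le_one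
      _ ≤ 1 * (2 / (1 - m) ^ 4 * (L * ‖x - x'‖ ^ (α:ℝ))) := by
          gcongr
          exact h3.trans (by gcongr)
      _ = _ := by ring

lemma limit_eqn {N : ℕ} (hN : 2 ≤ N) {Ω : Set (Euc N)} (hΩ : IsOpen Ω) {f W Z : Euc N → ℝ}
    {w z : ℕ → Euc N → ℝ} (hf : HypH Ω f)
    {lam m M : ℝ} (hlam : 0 < lam) (hm : m < 1) (hZ0 : ∀ x ∈ Ω, 0 ≤ Z x) (hZm : ∀ x ∈ Ω, Z x ≤ m)
    (hlip : ∀ x0 ∈ Ω, ∃ ρ > 0, ∃ L : ℝ, 0 ≤ L ∧ ∀ x ∈ ball x0 ρ, ∀ x' ∈ ball x0 ρ,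
        |Z x - Z x'| ≤ L * ‖x - x'‖) (hZc : ContinuousOn Z Ω) (hWc : ContinuousOn W Ω)
    (hw : ∀ n, ContDiffOn ℝ 2 (w n) Ω) (hw1 : ∀ n, ∀ x ∈ Ω, |w n x| ≤ 1)
    (hwM : ∀ n, ∀ x ∈ Ω, |lap (w n) x| ≤ M)
    (hW : ∀ x ∈ Ω, Tendsto (fun n => w n x) atTop (𝓝 (W x)))
    (hZ : ∀ x ∈ Ω, Tendsto (fun n => z n x) atTop (𝓝 (Z x)))
    (heq : ∀ n, ∀ x ∈ Ω, -lap (w (n+1)) x = lam * f x / (1 - z n x) ^ 2) :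
    ContDiffOn ℝ 2 W Ω ∧ ∀ x ∈ Ω, -lap W x = lam * f x / (1 - Z x) ^ 2 := by
  have hne : ∀ x ∈ Ω, (1 - Z x) ^ 2 ≠ 0 := by
    intro x hx
    have : 0 < 1 - Z x := by linarith [hZm x hx]
    positivity
  have hfc : ContinuousOn f Ω := by
    obtain ⟨⟨α, hα0, hα1, C, hC⟩, -, -⟩ := hf
    exact (hC.continuousOn hα0).mono subset_closure
  have key : ∀ x ∈ Ω, ContDiffAt ℝ 2 W x ∧ lap W x = -(lam * f x / (1 - Z x) ^ 2) := by
    intro x hx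
    refine lim_c2 (w := fun n => w (n+1)) (F := fun x => -(lam * f x / (1 - Z x) ^ 2)) hN hΩ
      (fun n => hw _) (fun n => hw1 _) (fun n => hwM _)
      (fun x hx => (hW x hx).comp (tendsto_add_atTop_nat 1)) ?_ hWc ?_ hx
      (rhs_holder hΩ hf hlam hm hZ0 hZm hx (hlip x hx))
    · intro y hy
      have h1 : ∀ n, lap (w (n+1)) y = -(lam * f y / (1 - z n y) ^ 2) := fun n => by
        rw [← heq n y hy, neg_neg]
      simp_rw [h1]
      exact (tendsto_const_nhds.div (((hZ y hy).const_sub 1).pow 2) (hne y hy)).neg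
    · exact ((continuousOn_const.mul hfc).div ((continuousOn_const.sub hZc).pow 2) hne).neg
  exact ⟨fun x hx => (key x hx).1.contDiffWithinAt, fun x hx => by rw [(key x hx).2, neg_neg]⟩

lemma rhs_bound {N : ℕ} {Ω : Set (Euc N)} {f : Euc N → ℝ} (hf : HypH Ω f)
    {lam m a : ℝ} (hlam : 0 < lam) (hm : m < 1) (ham : a ≤ m)
    {x : Euc N} (hx : x ∈ Ω) : |lam * f x / (1 - a) ^ 2| ≤ lam / (1 - m) ^ 2 := by
  have h1 := hf.2.1 x (subset_closure hx)
  have h2 : 0 ≤ lam * f x := mul_nonneg hlam.le h1.1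
  have h3 : 0 < 1 - m := by linarith
  rw [abs_of_nonneg (by positivity)]
  refine (mono_rhs h2 ham hm).trans ?_
  gcongr
  nlinarith

/-- **Lemma (existence and uniqueness of the minimal solution).** For `(λ,μ)` admitting a
classical solution and lying strictly below the critical curve, the iteration starting
from `(0,0)` is monotone increasing and converges uniformly to the unique minimal
classical solution of `S_{λ,μ}`. -/
theorem statement14 {N : ℕ} (hN : 2 ≤ N) (Ω : Set (Euc N)) (hΩ : IsBddDomain Ω)
    (f g : Euc N → ℝ) (hf : HypH Ω f) (hg : HypH Ω g)
    (lam mu : ℝ) (hlam : 0 < lam) (hmu : 0 < mu)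
    (hsol : ∃ u v : Euc N → ℝ, IsClassicalSolution Ω f g lam mu u v)
    (hbelow : ∃ lam' mu' : ℝ, lam < lam' ∧ mu < mu' ∧ (lam', mu') ∈ LambdaSet Ω f g)
    -- the iterates: `(u₀,v₀) = (0,0)` and `(uₙ,vₙ)` solves the linear problem
    (U V : ℕ → Euc N → ℝ)
    (hU0 : ∀ x, U 0 x = 0) (hV0 : ∀ x, V 0 x = 0)
    (hUiter : ∀ n : ℕ,
      ContDiffOn ℝ 2 (U (n+1)) Ω ∧ ContinuousOn (U (n+1)) (closure Ω) ∧
      (∀ x ∈ Ω, 0 < U (n+1) x ∧ U (n+1) x < 1) ∧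
      (∀ x ∈ frontier Ω, U (n+1) x = 0) ∧
      (∀ x ∈ Ω, -lap (U (n+1)) x = lam * f x / (1 - V n x) ^ 2))
    (hViter : ∀ n : ℕ,
      ContDiffOn ℝ 2 (V (n+1)) Ω ∧ ContinuousOn (V (n+1)) (closure Ω) ∧
      (∀ x ∈ Ω, 0 < V (n+1) x ∧ V (n+1) x < 1) ∧
      (∀ x ∈ frontier Ω, V (n+1) x = 0) ∧
      (∀ x ∈ Ω, -lap (V (n+1)) x = mu * g x / (1 - U n x) ^ 2)) :
    ∃ u v : Euc N → ℝ,
      (∀ x ∈ Ω, Monotone fun n => U n x) ∧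
      (∀ x ∈ Ω, Monotone fun n => V n x) ∧
      TendstoUniformlyOn (fun n => U n) u atTop Ω ∧
      TendstoUniformlyOn (fun n => V n) v atTop Ω ∧
      IsMinimalSolution Ω f g lam mu u v ∧
      (∀ U' V' : Euc N → ℝ, IsClassicalSolution Ω f g lam mu U' V' →
        ∀ x ∈ Ω, u x ≤ U' x ∧ v x ≤ V' x) ∧
      (∀ u' v' : Euc N → ℝ, IsMinimalSolution Ω f g lam mu u' v' →
        ∀ x ∈ Ω, u' x = u x ∧ v' x = v x) := by
  clear hbelow
  have hU0' : U 0 = fun _ => 0 := funext hU0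
  have hV0' : V 0 = fun _ => 0 := funext hV0
  have hUc2 : ∀ n, ContDiffOn ℝ 2 (U n) Ω := by
    rintro (_ | n)
    · rw [hU0']; exact contDiffOn_const
    · exact (hUiter n).1
  have hVc2 : ∀ n, ContDiffOn ℝ 2 (V n) Ω := by
    rintro (_ | n)
    · rw [hV0']; exact contDiffOn_const
    · exact (hViter n).1
  have hUc : ∀ n, ContinuousOn (U n) (closure Ω) := by
    rintro (_ | n)
    · rw [hU0']; exact continuousOn_const
    · exact (hUiter n).2.1
  have hVc : ∀ n, ContinuousOn (V n) (closure Ω) := by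
    rintro (_ | n)
    · rw [hV0']; exact continuousOn_const
    · exact (hViter n).2.1
  have hUb : ∀ n, ∀ x ∈ frontier Ω, U n x = 0 := by
    rintro (_ | n)
    · intro x _; exact hU0 x
    · exact (hUiter n).2.2.2.1
  have hVb : ∀ n, ∀ x ∈ frontier Ω, V n x = 0 := by
    rintro (_ | n)
    · intro x _; exact hV0 x
    · exact (hViter n).2.2.2.1
  have hUr : ∀ n, ∀ x ∈ Ω, 0 ≤ U n x ∧ U n x < 1 := by
    rintro (_ | n)
    · intro x _; rw [hU0 x]; norm_num
    · intro x hx; exact ⟨((hUiter n).2.2.1 x hx).1.le, ((hUiter n).2.2.1 x hx).2⟩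
  have hVr : ∀ n, ∀ x ∈ Ω, 0 ≤ V n x ∧ V n x < 1 := by
    rintro (_ | n)
    · intro x _; rw [hV0 x]; norm_num
    · intro x hx; exact ⟨((hViter n).2.2.1 x hx).1.le, ((hViter n).2.2.1 x hx).2⟩
  have hUe : ∀ n, ∀ x ∈ Ω, -lap (U (n+1)) x = lam * f x / (1 - V n x) ^ 2 :=
    fun n => (hUiter n).2.2.2.2
  have hVe : ∀ n, ∀ x ∈ Ω, -lap (V (n+1)) x = mu * g x / (1 - U n x) ^ 2 :=
    fun n => (hViter n).2.2.2.2
  have hlf : ∀ x ∈ Ω, 0 ≤ lam * f x := fun x hx =>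
    mul_nonneg hlam.le (hf.2.1 x (subset_closure hx)).1
  have hmg : ∀ x ∈ Ω, 0 ≤ mu * g x := fun x hx =>
    mul_nonneg hmu.le (hg.2.1 x (subset_closure hx)).1
  have hstep : ∀ n, (∀ x ∈ Ω, U n x ≤ U (n+1) x) ∧ (∀ x ∈ Ω, V n x ≤ V (n+1) x) := by
    intro n
    induction n with
    | zero =>
      exact ⟨fun x hx => by rw [hU0 x]; exact (hUr 1 x hx).1,
        fun x hx => by rw [hV0 x]; exact (hVr 1 x hx).1⟩
    | succ n ih =>
      constructor
      · refine comparison hN hΩ (hUc2 _) (hUc _) (hUc2 _) (hUc _) (fun x hx => ?_) (hUb _) (hUb _)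
        rw [hUe n x hx, hUe (n+1) x hx]
        exact mono_rhs (hlf x hx) (ih.2 x hx) (hVr _ x hx).2
      · refine comparison hN hΩ (hVc2 _) (hVc _) (hVc2 _) (hVc _) (fun x hx => ?_) (hVb _) (hVb _)
        rw [hVe n x hx, hVe (n+1) x hx]
        exact mono_rhs (hmg x hx) (ih.1 x hx) (hUr _ x hx).2
  have hUm : ∀ x ∈ Ω, Monotone fun n => U n x := fun x hx =>
    monotone_nat_of_le_succ fun n => (hstep n).1 x hx
  have hVm : ∀ x ∈ Ω, Monotone fun n => V n x := fun x hx =>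
    monotone_nat_of_le_succ fun n => (hstep n).2 x hx
  have hbel : ∀ U' V' : Euc N → ℝ, IsClassicalSolution Ω f g lam mu U' V' →
      ∀ n, (∀ x ∈ Ω, U n x ≤ U' x) ∧ (∀ x ∈ Ω, V n x ≤ V' x) := by
    intro U' V' hS n
    induction n with
    | zero =>
      exact ⟨fun x hx => by rw [hU0 x]; exact (hS.range_u x hx).1,
        fun x hx => by rw [hV0 x]; exact (hS.range_v x hx).1⟩
    | succ n ih =>
      constructor
      · refine comparison hN hΩ (hUc2 _) (hUc _) hS.smooth_u hS.cont_u (fun x hx => ?_) (hUb _)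
          hS.bdry_u
        rw [hUe n x hx, hS.eq_u x hx]
        exact mono_rhs (hlf x hx) (ih.2 x hx) (hS.range_v x hx).2
      · refine comparison hN hΩ (hVc2 _) (hVc _) hS.smooth_v hS.cont_v (fun x hx => ?_) (hVb _)
          hS.bdry_v
        rw [hVe n x hx, hS.eq_v x hx]
        exact mono_rhs (hmg x hx) (ih.1 x hx) (hS.range_u x hx).2
  obtain ⟨us, vs, hS⟩ := hsol
  have hbs := hbel us vs hS
  obtain ⟨m1, hm10, hm11, hm1⟩ := exists_max hΩ hS.cont_u hS.range_u hS.bdry_u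
  obtain ⟨m2, hm20, hm21, hm2⟩ := exists_max hΩ hS.cont_v hS.range_v hS.bdry_v
  have hUM : ∀ n, ∀ x ∈ Ω, |lap (U n) x| ≤ lam / (1 - m2) ^ 2 := by
    rintro (_ | n) x hx
    · rw [hU0', lap_zero', abs_zero]; positivity
    · rw [← abs_neg, hUe n x hx]
      exact rhs_bound hf hlam hm21 (((hbs n).2 x hx).trans (hm2 x hx)) hx
  have hVM : ∀ n, ∀ x ∈ Ω, |lap (V n) x| ≤ mu / (1 - m1) ^ 2 := by
    rintro (_ | n) x hx
    · rw [hV0', lap_zero', abs_zero]; positivity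
    · rw [← abs_neg, hVe n x hx]
      exact rhs_bound hg hmu hm11 (((hbs n).1 x hx).trans (hm1 x hx)) hx
  obtain ⟨u, hut, hul, huc, huu, hub, hu0⟩ := conv hN hΩ hS.cont_u hS.bdry_u
    (fun x hx => (hS.range_u x hx).2) hUc2 hUc hUb (fun n x hx => (hUr n x hx).1)
    (fun n => (hbs n).1) hUM hUm
  obtain ⟨v, hvt, hvl, hvc, hvu, hvb, hv0⟩ := conv hN hΩ hS.cont_v hS.bdry_v
    (fun x hx => (hS.range_v x hx).2) hVc2 hVc hVb (fun n x hx => (hVr n x hx).1)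
    (fun n => (hbs n).2) hVM hVm
  have hmin : ∀ U' V' : Euc N → ℝ, IsClassicalSolution Ω f g lam mu U' V' →
      ∀ x ∈ Ω, u x ≤ U' x ∧ v x ≤ V' x := fun U' V' hS' x hx =>
    ⟨le_of_tendsto' (hut x hx) fun n => (hbel U' V' hS' n).1 x hx,
      le_of_tendsto' (hvt x hx) fun n => (hbel U' V' hS' n).2 x hx⟩
  have hum : ∀ x ∈ Ω, u x ≤ m1 := fun x hx => (hmin us vs hS x hx).1.trans (hm1 x hx)
  have hvm : ∀ x ∈ Ω, v x ≤ m2 := fun x hx => (hmin us vs hS x hx).2.trans (hm2 x hx)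
  have hUabs : ∀ n, ∀ x ∈ Ω, |U n x| ≤ 1 := fun n x hx => by
    rw [abs_of_nonneg (hUr n x hx).1]; exact (hUr n x hx).2.le
  have hVabs : ∀ n, ∀ x ∈ Ω, |V n x| ≤ 1 := fun n x hx => by
    rw [abs_of_nonneg (hVr n x hx).1]; exact (hVr n x hx).2.le
  have eu := limit_eqn hN hΩ.1 hf hlam hm21 hv0 hvm hvl (hvc.mono subset_closure)
    (huc.mono subset_closure) hUc2 hUabs hUM hut hvt hUe
  have ev' := limit_eqn hN hΩ.1 hg hmu hm11 hu0 hum hul (huc.mono subset_closure)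
    (hvc.mono subset_closure) hVc2 hVabs hVM hvt hut hVe
  have hsolu : IsClassicalSolution Ω f g lam mu u v :=
    { smooth_u := eu.1
      smooth_v := ev'.1
      cont_u := huc
      cont_v := hvc
      range_u := fun x hx => ⟨hu0 x hx, (hum x hx).trans_lt hm11⟩
      range_v := fun x hx => ⟨hv0 x hx, (hvm x hx).trans_lt hm21⟩
      bdry_u := hub
      bdry_v := hvb
      eq_u := eu.2
      eq_v := ev'.2 }
  refine ⟨u, v, hUm, hVm, huu, hvu, ⟨hsolu, hmin⟩, hmin, ?_⟩
  intro u' v' h' x hx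
  have h1 := hmin u' v' h'.1 x hx
  have h2 := h'.2 u v hsolu x hx
  exact ⟨le_antisymm h2.1 h1.1, le_antisymm h2.2 h1.2⟩
end
end

section
/- Suppose (λ,μ) ∈ Λ with 0 < μ ≤ λ, let (u,v) be the minimal solution of the system S_{λ,μ} (with f ≡ g ≡ 1), and let (φ₁, φ₂) be the positive first eigenfunction pair of the linearized eigenvalue problem −Δφ₁ − (2λ/(1−v)³)φ₂ = ν φ₁, −Δφ₂ − (2μ/(1−u)³)φ₁ = ν φ₂ in Ω with φ₁ = φ₂ = 0 on ∂Ω, associated with the first eigenvalue ν₁. Then φ₂(x)/φ₁(x) ≥ μ/λ for all x ∈ Ω. -/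
open MeasureTheory Metric Set Filter Topology

noncomputable section

lemma sd_le {N : ℕ} {Ω : Set (Euc N)} (hΩ : IsOpen Ω) {x : Euc N} (hx : x ∈ Ω)
    {f g : Euc N → ℝ} (hf : ContDiffOn ℝ 2 f Ω) (hg : ContDiffOn ℝ 2 g Ω) (a b : ℝ)
    (hmax : ∀ y ∈ Ω, a * f y + b * g y ≤ a * f x + b * g x) (i : Fin N) :
    a * secondDerivCoord f i x + b * secondDerivCoord g i x ≤ 0 := by
  set e : Euc N := EuclideanSpace.single i (1:ℝ) with he
  have hline : ∀ t : ℝ, HasDerivAt (fun s : ℝ => x + s • e) e t := by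
    intro t
    simpa using ((hasDerivAt_id t).smul_const e).const_add x
  have hnear : ∀ᶠ t : ℝ in 𝓝 0, x + t • e ∈ Ω := by
    have hc : ContinuousAt (fun s : ℝ => x + s • e) 0 := (hline 0).continuousAt
    apply hc.eventually_mem
    simpa using hΩ.mem_nhds hx
  have d1 : ∀ {f : Euc N → ℝ}, ContDiffOn ℝ 2 f Ω → ∀ t : ℝ, x + t • e ∈ Ω →
      HasDerivAt (fun s : ℝ => f (x + s • e)) (fderiv ℝ f (x + t • e) e) t := by
    intro f hf t ht
    have h1 : DifferentiableAt ℝ f (x + t • e) :=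
      (hf.differentiableOn (by norm_num)).differentiableAt (hΩ.mem_nhds ht)
    exact h1.hasFDerivAt.comp_hasDerivAt t (hline t)
  have d2 : ∀ {f : Euc N → ℝ}, ContDiffOn ℝ 2 f Ω →
      HasDerivAt (fun s : ℝ => fderiv ℝ f (x + s • e) e) (secondDerivCoord f i x) 0 := by
    intro f hf
    have h1 : ContDiffOn ℝ 1 (fderiv ℝ f) Ω := hf.fderiv_of_isOpen hΩ (by norm_num)
    have h2 : DifferentiableAt ℝ (fderiv ℝ f) (x + (0:ℝ) • e) := by
      have hx' : x + (0:ℝ) • e ∈ Ω := by simpa using hx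
      exact (h1.differentiableOn (by norm_num)).differentiableAt (hΩ.mem_nhds hx')
    have h3 : DifferentiableAt ℝ (fun s : ℝ => fderiv ℝ f (x + s • e)) 0 :=
      h2.comp (0:ℝ) (hline 0).differentiableAt
    have h4 : DifferentiableAt ℝ (fun s : ℝ => fderiv ℝ f (x + s • e) e) 0 :=
      h3.clm_apply (differentiableAt_const e)
    exact h4.hasDerivAt
  set F : ℝ → ℝ := fun t => a * f (x + t • e) + b * g (x + t • e) with hF
  have hF1 : ∀ᶠ t : ℝ in 𝓝 0, HasDerivAt F
      (a * fderiv ℝ f (x + t • e) e + b * fderiv ℝ g (x + t • e) e) t := by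
    filter_upwards [hnear] with t ht
    exact ((d1 hf t ht).const_mul a).add ((d1 hg t ht).const_mul b)
  have hF2 : deriv F =ᶠ[𝓝 0]
      fun t => a * fderiv ℝ f (x + t • e) e + b * fderiv ℝ g (x + t • e) e := by
    filter_upwards [hF1] with t ht using ht.deriv
  have hF3 : deriv (deriv F) 0 = a * secondDerivCoord f i x + b * secondDerivCoord g i x := by
    rw [hF2.deriv_eq]
    exact (((d2 hf).const_mul a).add ((d2 hg).const_mul b)).deriv
  rw [← hF3]
  have hlm : IsLocalMax F 0 := by
    filter_upwards [hnear] with t ht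
    simpa [hF] using hmax _ ht
  by_contra! hpos
  have hmin := isLocalMin_of_deriv_deriv_pos hpos hlm.deriv_eq_zero
    hF1.self_of_nhds.continuousAt
  have hconst : F =ᶠ[𝓝 0] fun _ => F 0 := by
    filter_upwards [hmin, hlm] with t h1 h2 using le_antisymm h2 h1
  have : deriv (deriv F) 0 = 0 := by
    rw [hconst.deriv.deriv_eq]; simp
  linarith

lemma lap_le {N : ℕ} {Ω : Set (Euc N)} (hΩ : IsOpen Ω) {x : Euc N} (hx : x ∈ Ω)
    {f g : Euc N → ℝ} (hf : ContDiffOn ℝ 2 f Ω) (hg : ContDiffOn ℝ 2 g Ω) (a b : ℝ)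
    (hmax : ∀ y ∈ Ω, a * f y + b * g y ≤ a * f x + b * g x) :
    a * lap f x + b * lap g x ≤ 0 := by
  unfold lap
  rw [Finset.mul_sum, Finset.mul_sum, ← Finset.sum_add_distrib]
  exact Finset.sum_nonpos fun i _ => sd_le hΩ hx hf hg a b hmax i

lemma v_le_u {N : ℕ} {Ω : Set (Euc N)} (hΩ : IsBddDomain Ω) {lam mu : ℝ}
    (hmu : 0 < mu) (hml : mu ≤ lam) {u v : Euc N → ℝ}
    (h : IsClassicalSolution Ω (fun _ => (1:ℝ)) (fun _ => (1:ℝ)) lam mu u v) :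
    ∀ x ∈ Ω, v x ≤ u x := by
  obtain ⟨ho, hb, hne⟩ := hΩ
  have hK : IsCompact (closure Ω) := hb.isCompact_closure
  obtain ⟨x0, hx0, hm⟩ := hK.exists_isMaxOn hne.closure (h.cont_v.sub h.cont_u)
  intro x hx
  by_contra! hlt
  have hm' : ∀ y ∈ Ω, v y - u y ≤ v x0 - u x0 := fun y hy => hm (subset_closure hy)
  have hp := hm' x hx
  have hx0Ω : x0 ∈ Ω := by
    by_contra hn
    have hf : x0 ∈ frontier Ω := by
      rw [frontier, ho.interior_eq]; exact ⟨hx0, hn⟩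
    rw [h.bdry_u _ hf, h.bdry_v _ hf] at hp
    linarith
  have hl := lap_le ho hx0Ω h.smooth_v h.smooth_u 1 (-1)
    (fun y hy => by have := hm' y hy; linarith)
  have e1 := h.eq_u x0 hx0Ω
  have e2 := h.eq_v x0 hx0Ω
  simp only [mul_one] at e1 e2
  have hv := h.range_v x0 hx0Ω
  have hu := h.range_u x0 hx0Ω
  have hvp : 0 < 1 - v x0 := by linarith
  have hlt2 : mu / (1 - u x0)^2 < lam / (1 - v x0)^2 := by
    apply div_lt_div₀' hml _ (by linarith) (by positivity)
    apply pow_lt_pow_left₀ <;> first | linarith | norm_num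
  linarith

lemma tangent {p q a : ℝ} (hp : 0 < p) (hq : 0 < q) (ha0 : 0 ≤ a) (ha1 : a ≤ 1) :
    p ^ a ≤ q ^ a * (1 + a * (p / q - 1)) := by
  have h := rpow_one_add_le_one_add_mul_self (s := p / q - 1) (p := a)
    (by have : 0 < p / q := by positivity
        linarith) ha0 ha1
  have e : (1 + (p / q - 1)) = p / q := by ring
  rw [e, Real.div_rpow hp.le hq.le, div_le_iff₀ (by positivity)] at h
  linarith

/-- **Proposition (lower bound on the eigenfunction ratio).** If `(λ,μ) ∈ Λ` with
`0 < μ ≤ λ`, `(u,v)` is the minimal solution of `S_{λ,μ}` (with `f ≡ g ≡ 1`) and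
`(φ₁,φ₂)` is the positive first eigenfunction pair of the linearized problem with
eigenvalue `ν₁`, then `φ₂/φ₁ ≥ μ/λ` in `Ω`. -/
theorem statement15 {N : ℕ} (hN : 2 ≤ N) (Ω : Set (Euc N)) (hΩ : IsBddDomain Ω)
    (lam mu : ℝ) (hmu : 0 < mu) (hml : mu ≤ lam)
    (hmem : (lam, mu) ∈ LambdaSet Ω (fun _ => (1:ℝ)) (fun _ => (1:ℝ)))
    (u v : Euc N → ℝ)
    (hmin : IsMinimalSolution Ω (fun _ => (1:ℝ)) (fun _ => (1:ℝ)) lam mu u v)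
    (ν₁ : ℝ) (φ₁ φ₂ : Euc N → ℝ)
    (hφ₁s : ContDiffOn ℝ 2 φ₁ Ω) (hφ₂s : ContDiffOn ℝ 2 φ₂ Ω)
    (hφ₁c : ContinuousOn φ₁ (closure Ω)) (hφ₂c : ContinuousOn φ₂ (closure Ω))
    (hφ₁pos : ∀ x ∈ Ω, 0 < φ₁ x) (hφ₂pos : ∀ x ∈ Ω, 0 < φ₂ x)
    (hφ₁b : ∀ x ∈ frontier Ω, φ₁ x = 0) (hφ₂b : ∀ x ∈ frontier Ω, φ₂ x = 0)
    (heig₁ : ∀ x ∈ Ω, -lap φ₁ x - (2 * lam / (1 - v x) ^ 3) * φ₂ x = ν₁ * φ₁ x)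
    (heig₂ : ∀ x ∈ Ω, -lap φ₂ x - (2 * mu / (1 - u x) ^ 3) * φ₁ x = ν₁ * φ₂ x) :
    ∀ x ∈ Ω, mu / lam ≤ φ₂ x / φ₁ x := by
  obtain ⟨hsol, -⟩ := hmin
  have hvu := v_le_u hΩ hmu hml hsol
  obtain ⟨ho, hb, hne⟩ := hΩ
  have hlam : 0 < lam := lt_of_lt_of_le hmu hml
  set c := mu / lam with hc
  have hc0 : 0 < c := by positivity
  have hc1 : c ≤ 1 := by rw [hc, div_le_one hlam]; exact hml
  have hcl : c * lam = mu := by rw [hc]; field_simp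
  intro x1 hx1
  rw [le_div_iff₀ (hφ₁pos x1 hx1)]
  by_contra! hz1
  -- choice of the exponent
  obtain ⟨a, ha0, ha1, haν⟩ : ∃ a : ℝ, 0 < a ∧ a < 1 ∧ ν₁ - 2 * mu < a * ν₁ := by
    have hd : 0 < 2 * mu + |ν₁| := by positivity
    refine ⟨1 - mu / (2 * mu + |ν₁|), ?_, ?_, ?_⟩
    · rw [sub_pos, div_lt_one hd]
      have := abs_nonneg ν₁
      linarith
    · have : 0 < mu / (2 * mu + |ν₁|) := by positivity
      linarith
    · have h1 : mu / (2 * mu + |ν₁|) * ν₁ ≤ mu := by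
        rw [div_mul_eq_mul_div, div_le_iff₀ hd]
        have := le_abs_self ν₁
        nlinarith
      linarith
  set z : Euc N → ℝ := fun x => c * φ₁ x - φ₂ x with hz
  set h : Euc N → ℝ := fun x => z x / (φ₁ x) ^ a with hh
  have hz1' : 0 < z x1 := by simp only [hz]; linarith
  have hh1 : 0 < h x1 := div_pos hz1' (Real.rpow_pos_of_pos (hφ₁pos x1 hx1) a)
  have hub : ∀ x ∈ Ω, h x < c * φ₁ x ^ (1 - a) := by
    intro x hx
    have hp := hφ₁pos x hx
    have hq := hφ₂pos x hx
    simp only [hh]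
    rw [div_lt_iff₀ (by positivity), mul_assoc, ← Real.rpow_add hp]
    simp only [sub_add_cancel, Real.rpow_one, hz]
    linarith
  set ε : ℝ := (h x1 / c) ^ (1 - a)⁻¹ with hε
  have hε0 : 0 < ε := by positivity
  have hsmall : ∀ x ∈ Ω, φ₁ x < ε → h x < h x1 := by
    intro x hx hlt
    have h1 : φ₁ x ^ (1 - a) < ε ^ (1 - a) :=
      Real.rpow_lt_rpow (hφ₁pos x hx).le hlt (by linarith)
    rw [hε, Real.rpow_inv_rpow (by positivity) (by linarith), lt_div_iff₀ hc0] at h1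
    have := hub x hx
    linarith
  set K : Set (Euc N) := closure Ω ∩ φ₁ ⁻¹' (Ici ε) with hKdef
  have hK : IsCompact K := by
    apply hb.isCompact_closure.of_isClosed_subset _ inter_subset_left
    exact hφ₁c.preimage_isClosed_of_isClosed isClosed_closure isClosed_Ici
  have hKΩ : K ⊆ Ω := by
    rintro x ⟨hx, hxe⟩
    by_contra hn
    have hf : x ∈ frontier Ω := by
      rw [frontier, ho.interior_eq]; exact ⟨hx, hn⟩
    have := hφ₁b x hf
    simp only [mem_preimage, mem_Ici] at hxe
    linarith
  have hx1K : x1 ∈ K := by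
    refine ⟨subset_closure hx1, ?_⟩
    by_contra hn
    simp only [mem_preimage, mem_Ici, not_le] at hn
    exact lt_irrefl _ (hsmall x1 hx1 hn)
  have hcont : ContinuousOn h K := by
    have c1 : ContinuousOn φ₁ K := hφ₁c.mono inter_subset_left
    have c2 : ContinuousOn φ₂ K := hφ₂c.mono inter_subset_left
    apply ContinuousOn.div
    · exact (continuousOn_const.mul c1).sub c2
    · exact c1.rpow_const fun x hx => Or.inl (hφ₁pos x (hKΩ hx)).ne'
    · intro x hx
      exact (Real.rpow_pos_of_pos (hφ₁pos x (hKΩ hx)) a).ne'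
  obtain ⟨x0, hx0, hm⟩ := hK.exists_isMaxOn ⟨x1, hx1K⟩ hcont
  have hx0Ω := hKΩ hx0
  have h01 : h x1 ≤ h x0 := hm hx1K
  have hmax : ∀ x ∈ Ω, h x ≤ h x0 := by
    intro x hx
    by_cases hxe : φ₁ x < ε
    · exact (hsmall x hx hxe).le.trans h01
    · exact hm ⟨subset_closure hx, not_lt.mp hxe⟩
  set M := h x0 with hM
  have hM0 : 0 < M := by linarith
  have hp0 := hφ₁pos x0 hx0Ω
  have hq0 := hφ₂pos x0 hx0Ω
  have hpa : 0 < φ₁ x0 ^ a := Real.rpow_pos_of_pos hp0 a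
  have hz0 : z x0 = M * φ₁ x0 ^ a := by
    rw [hM]; simp only [hh]; field_simp
  set B := a * z x0 / φ₁ x0 with hB
  have hBp : B * φ₁ x0 = a * z x0 := by rw [hB]; field_simp
  have hz0p : 0 < z x0 := by rw [hz0]; positivity
  have hB0 : 0 < B := by positivity
  have htouch : ∀ y ∈ Ω, z y - B * φ₁ y ≤ z x0 - B * φ₁ x0 := by
    intro y hy
    have hpy := hφ₁pos y hy
    have h1 : z y ≤ M * φ₁ y ^ a := by
      have := hmax y hy
      simp only [hh] at this
      rwa [div_le_iff₀ (by positivity)] at this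
    have h2 := tangent hpy hp0 ha0.le ha1.le
    have h3 := mul_le_mul_of_nonneg_left h2 hM0.le
    rw [← mul_assoc, ← hz0] at h3
    have h4 : z x0 * (1 + a * (φ₁ y / φ₁ x0 - 1)) = z x0 + B * φ₁ y - B * φ₁ x0 := by
      rw [hB]; field_simp; ring
    linarith
  have hl := lap_le ho hx0Ω hφ₁s hφ₂s (c - B) (-1)
    (fun y hy => by have := htouch y hy; simp only [hz] at this; linarith)
  have e1 := heig₁ x0 hx0Ω
  have e2 := heig₂ x0 hx0Ω
  have hv := hsol.range_v x0 hx0Ω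
  have hu := hsol.range_u x0 hx0Ω
  have hvu0 := hvu x0 hx0Ω
  have hup : 0 < 1 - u x0 := by linarith
  have hvp : 0 < 1 - v x0 := by linarith
  set k := 1 / (1 - v x0) ^ 3 with hk
  set l := 1 / (1 - u x0) ^ 3 with hl'
  have hkl : k ≤ l := by
    apply one_div_le_one_div_of_le (by positivity)
    apply pow_le_pow_left₀ hup.le; linarith
  have hk1 : 1 ≤ k := by
    rw [hk, le_div_iff₀ (by positivity), one_mul]
    apply pow_le_one₀ hvp.le; linarith
  have f1 : 2 * lam / (1 - v x0) ^ 3 = 2 * lam * k := by rw [hk]; ring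
  have f2 : 2 * mu / (1 - u x0) ^ 3 = 2 * mu * l := by rw [hl']; ring
  rw [f1] at e1
  rw [f2] at e2
  have hz0e : z x0 = c * φ₁ x0 - φ₂ x0 := rfl
  have hbr : z x0 ≤ l * φ₁ x0 - k * φ₂ x0 := by
    have g1 : k * φ₁ x0 ≤ l * φ₁ x0 := mul_le_mul_of_nonneg_right hkl hp0.le
    have g2 : z x0 ≤ φ₁ x0 - φ₂ x0 := by
      have := mul_le_mul_of_nonneg_right hc1 hp0.le
      linarith
    have g3 : φ₁ x0 - φ₂ x0 ≤ k * (φ₁ x0 - φ₂ x0) := by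
      apply le_mul_of_one_le_left _ hk1; linarith
    linarith
  have E1 : lap φ₁ x0 = -(2 * lam * k * φ₂ x0) - ν₁ * φ₁ x0 := by linarith
  have E2 : lap φ₂ x0 = -(2 * mu * l * φ₁ x0) - ν₁ * φ₂ x0 := by linarith
  rw [E1, E2] at hl
  have s1 : 0 < B * (2 * lam * k * φ₂ x0) := by positivity
  have s2 : (c - B) * (-(2 * lam * k * φ₂ x0) - ν₁ * φ₁ x0)
        + -1 * (-(2 * mu * l * φ₁ x0) - ν₁ * φ₂ x0)
      = 2 * mu * (l * φ₁ x0 - k * φ₂ x0) - ν₁ * z x0 + ν₁ * (B * φ₁ x0)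
        + B * (2 * lam * k * φ₂ x0) := by
    rw [hz0e, ← hcl]; ring
  rw [s2, hBp] at hl
  have s3 := mul_le_mul_of_nonneg_left hbr (by positivity : 0 ≤ 2 * mu)
  have s4 := mul_lt_mul_of_pos_right haν hz0p
  linarith
end
end
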